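/- arXiv:1212.4056 — 6 statements merged into one kernel-verified Lean document; each statement's English description precedes it below -/
import Mathlib

section
/- Let Γ be a finite-index subgroup of SL(2,ℤ), let α₁, …, αₙ be finitely many matrices in GL(2,ℚ) with positive determinant, and let X = Γα₁Γ ∪ ⋯ ∪ ΓαₙΓ ⊆ GL(2,ℚ) be the corresponding finite union of double cosets. Then the set Fix(X) = {u ∈ ℍ : there exists g ∈ X which is not a scalar multiple of the identity matrix and which satisfies g•u = u} is a finite union of Γ-orbits; that is, there is a finite subset F ⊆ ℍ with Fix(X) = {γ•z : γ ∈ Γ, z ∈ F}. -/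
open Matrix

/-- The Möbius action of a rational 2×2 matrix on a complex number. -/
noncomputable def moebius (g : Matrix (Fin 2) (Fin 2) ℚ) (z : ℂ) : ℂ :=
  ((g 0 0 : ℂ) * z + (g 0 1 : ℂ)) / ((g 1 0 : ℂ) * z + (g 1 1 : ℂ))

/-- The inclusion of `SL(2, ℤ)` into 2×2 rational matrices. -/
def toQ (γ : Matrix.SpecialLinearGroup (Fin 2) ℤ) : Matrix (Fin 2) (Fin 2) ℚ :=
  (γ : Matrix (Fin 2) (Fin 2) ℤ).map (fun a => (a : ℚ))

/-- `u` is a root of an integral binary quadratic form whose discriminant lies in `[-K, 0)`. -/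
def IsRootOfForm (K : ℤ) (u : UpperHalfPlane) : Prop :=
  ∃ p q r : ℤ, 0 < 4 * p * r - q ^ 2 ∧ 4 * p * r - q ^ 2 ≤ K ∧
    (p : ℂ) * (u : ℂ) ^ 2 + q * u + r = 0

theorem quadratic_coeffs_of_root {p q r : ℤ} {u : UpperHalfPlane}
    (h : (p : ℂ) * (u : ℂ) ^ 2 + q * u + r = 0) :
    (q : ℝ) = -2 * p * u.re ∧ (r : ℝ) = p * (u.re ^ 2 + u.im ^ 2) := by
  have hre := congrArg Complex.re h
  have him := congrArg Complex.im h
  simp [pow_two] at hre him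
  have hq : (q : ℝ) = -2 * p * u.re := by
    have hy : u.im ≠ 0 := u.im_ne_zero
    apply mul_right_cancel₀ hy
    linarith
  refine ⟨hq, ?_⟩
  rw [hq] at hre
  linarith

theorem neg_discr_pos_of_root {p q r : ℤ} {u : UpperHalfPlane}
    (h : (p : ℂ) * (u : ℂ) ^ 2 + q * u + r = 0) (hne : ¬(p = 0 ∧ q = 0 ∧ r = 0)) :
    0 < 4 * p * r - q ^ 2 := by
  obtain ⟨hq, hr⟩ := quadratic_coeffs_of_root h
  have hp : p ≠ 0 := by
    rintro rfl
    refine hne ⟨rfl, ?_, ?_⟩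
    · simpa using hq
    · simpa using hr
  have hp' : (p : ℝ) ≠ 0 := mod_cast hp
  have hy := u.im_pos
  have : (0 : ℝ) < 4 * p * r - q ^ 2 := by
    rw [hq, hr]
    have : 0 < 4 * ((p : ℝ) * u.im) ^ 2 := by positivity
    linarith
  exact_mod_cast this

theorem toQ_denom_ne_zero (γ : SpecialLinearGroup (Fin 2) ℤ) (u : UpperHalfPlane) :
    ((toQ γ 1 0 : ℚ) : ℂ) * u + (toQ γ 1 1 : ℚ) ≠ 0 := by
  simpa [toQ, UpperHalfPlane.denom] using UpperHalfPlane.denom_ne_zero (γ : GL (Fin 2) ℝ) u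

theorem IsRootOfForm.smul {K : ℤ} {u : UpperHalfPlane} (h : IsRootOfForm K u)
    (γ : SpecialLinearGroup (Fin 2) ℤ) : IsRootOfForm K (γ • u) := by
  obtain ⟨p, q, r, hpos, hle, hroot⟩ := h
  obtain ⟨v, rfl⟩ : ∃ v, u = γ⁻¹ • v := ⟨γ • u, by simp⟩
  rw [smul_inv_smul]
  generalize γ⁻¹ = δ at hroot
  have hdet := δ.det_coe
  rw [det_fin_two] at hdet
  have hden : (v : ℂ) * δ 1 0 + δ 1 1 ≠ 0 := by
    simpa [toQ, mul_comm] using toQ_denom_ne_zero δ v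
  rw [UpperHalfPlane.specialLinearGroup_apply] at hroot
  simp only [algebraMap_int_eq, eq_intCast, Complex.ofReal_intCast] at hroot
  refine ⟨p * δ 0 0 ^ 2 + q * δ 0 0 * δ 1 0 + r * δ 1 0 ^ 2,
    2 * p * δ 0 0 * δ 0 1 + q * (δ 0 0 * δ 1 1 + δ 0 1 * δ 1 0) + 2 * r * δ 1 0 * δ 1 1,
    p * δ 0 1 ^ 2 + q * δ 0 1 * δ 1 1 + r * δ 1 1 ^ 2, ?_, ?_, ?_⟩
  · convert hpos using 1
    linear_combination (4 * p * r - q ^ 2) * (δ 0 0 * δ 1 1 - δ 0 1 * δ 1 0 + 1) * hdet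
  · convert hle using 1
    linear_combination (4 * p * r - q ^ 2) * (δ 0 0 * δ 1 1 - δ 0 1 * δ 1 0 + 1) * hdet
  · push_cast
    field_simp at hroot
    linear_combination hroot

theorem finite_setOf_root {p q r : ℤ} (hp : p ≠ 0) :
    {u : UpperHalfPlane | (p : ℂ) * (u : ℂ) ^ 2 + q * u + r = 0}.Finite := by
  refine Set.Subsingleton.finite fun u hu v hv => ?_
  obtain ⟨hq, hr⟩ := quadratic_coeffs_of_root hu
  obtain ⟨hq', hr'⟩ := quadratic_coeffs_of_root hv
  have hp' : (p : ℝ) ≠ 0 := mod_cast hp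
  have hre : u.re = v.re := by
    apply mul_left_cancel₀ hp'
    linarith
  have him : u.im = v.im := by
    have : u.re ^ 2 + u.im ^ 2 = v.re ^ 2 + v.im ^ 2 := by
      apply mul_left_cancel₀ hp'
      linarith
    rw [hre] at this
    exact (sq_eq_sq₀ u.im_pos.le v.im_pos.le).1 (by linarith)
  exact UpperHalfPlane.ext (Complex.ext hre him)

/-- Reduction theory: only finitely many points of the standard fundamental domain are roots of
forms of bounded negative discriminant. -/
theorem finite_isRootOfForm_inter_fd (K : ℤ) :
    {u : UpperHalfPlane | IsRootOfForm K u ∧ u ∈ ModularGroup.fd}.Finite := by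
  refine Set.Finite.subset (s := ⋃ t ∈ {t ∈ Set.Icc (-K) K ×ˢ Set.Icc (-K) K ×ˢ
    Set.Icc (-K) K | t.1 ≠ 0},
    {u : UpperHalfPlane | (t.1 : ℂ) * (u : ℂ) ^ 2 + t.2.1 * u + t.2.2 = 0}) ?_ ?_
  · refine Set.Finite.biUnion (Set.Finite.subset ?_ (Set.sep_subset _ _))
      fun t ht => finite_setOf_root ht.2
    exact (Set.finite_Icc _ _).prod ((Set.finite_Icc _ _).prod (Set.finite_Icc _ _))
  · rintro u ⟨⟨p, q, r, hpos, hle, hroot⟩, hnorm, habs⟩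
    obtain ⟨hq, hr⟩ := quadratic_coeffs_of_root hroot
    have hp : p ≠ 0 := by
      rintro rfl
      nlinarith [sq_nonneg q]
    have hp1 : 1 ≤ p ^ 2 := by
      have : 0 < p ^ 2 := by positivity
      omega
    have hnorm' : 1 ≤ u.re ^ 2 + u.im ^ 2 := by
      have h : Complex.normSq (u : ℂ) = u.re ^ 2 + u.im ^ 2 := by
        simp [Complex.normSq_apply, pow_two]
      linarith
    have hx : u.re ^ 2 ≤ 1 / 4 := by
      have := abs_le.1 habs
      nlinarith
    have hqp : q ^ 2 ≤ p ^ 2 := by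
      have : (q : ℝ) ^ 2 ≤ p ^ 2 := by
        rw [hq]
        nlinarith [sq_nonneg (p : ℝ)]
      exact_mod_cast this
    have hpr : p ^ 2 ≤ p * r := by
      have : (p : ℝ) ^ 2 ≤ p * r := by
        rw [hr]
        nlinarith [sq_nonneg (p : ℝ)]
      exact_mod_cast this
    have hpK : p ^ 2 ≤ K := by linarith
    have hqK : q ^ 2 ≤ K := by linarith
    have hrK : |r| ≤ K := by
      have h1 : |r| ≤ |p| * |r| := le_mul_of_one_le_left (abs_nonneg r) (Int.one_le_abs hp)
      rw [← abs_mul, abs_of_nonneg (show 0 ≤ p * r by linarith)] at h1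
      linarith
    have key : ∀ t : ℤ, t ^ 2 ≤ K → t ∈ Set.Icc (-K) K := fun t ht =>
      ⟨by nlinarith [sq_nonneg t, Int.le_self_sq (-t)], by linarith [Int.le_self_sq t]⟩
    simp only [Set.mem_iUnion]
    refine ⟨(p, q, r), ⟨⟨key p hpK, key q hqK, ?_⟩, hp⟩, hroot⟩
    exact abs_le.1 hrK

theorem exists_finite_reps_isRootOfForm (K : ℤ) :
    ∃ T : Set UpperHalfPlane, T.Finite ∧ ∀ u, IsRootOfForm K u →
      ∃ γ : SpecialLinearGroup (Fin 2) ℤ, ∃ t ∈ T, u = γ • t := by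
  refine ⟨_, finite_isRootOfForm_inter_fd K, fun u hu => ?_⟩
  obtain ⟨γ, hγ⟩ := ModularGroup.exists_smul_mem_fd u
  exact ⟨γ⁻¹, γ • u, ⟨hu.smul γ, hγ⟩, by simp⟩

theorem exists_int_smul_eq_map (α : Matrix (Fin 2) (Fin 2) ℚ) :
    ∃ N : ℤ, N ≠ 0 ∧ ∃ B : Matrix (Fin 2) (Fin 2) ℤ, B.map (fun a => (a : ℚ)) = (N : ℚ) • α := by
  obtain ⟨N, hN⟩ := IsLocalization.exist_integer_multiples_of_finite (nonZeroDivisors ℤ)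
    (fun ij : Fin 2 × Fin 2 => α ij.1 ij.2)
  choose B hB using hN
  refine ⟨N, nonZeroDivisors.coe_ne_zero N, Matrix.of fun i j => B (i, j), ?_⟩
  ext i j
  simpa using hB (i, j)

theorem denom_ne_zero_of_moebius_eq_self {g : Matrix (Fin 2) (Fin 2) ℚ} {u : UpperHalfPlane}
    (h : moebius g u = u) : (g 1 0 : ℂ) * u + g 1 1 ≠ 0 := by
  intro hD
  rw [moebius, hD, div_zero] at h
  exact u.ne_zero h.symm

theorem quadratic_of_moebius_eq_self {g : Matrix (Fin 2) (Fin 2) ℚ} {u : UpperHalfPlane}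
    (h : moebius g u = u) :
    (g 1 0 : ℂ) * (u : ℂ) ^ 2 + ((g 1 1 : ℂ) - g 0 0) * u - g 0 1 = 0 := by
  rw [moebius, div_eq_iff (denom_ne_zero_of_moebius_eq_self h)] at h
  linear_combination -h

/-- The non-scalar fixed points of a double coset `SL(2, ℤ) α SL(2, ℤ)` are roots of integral
quadratic forms of bounded negative discriminant. -/
theorem exists_isRootOfForm_of_moebius_eq_self (α : Matrix (Fin 2) (Fin 2) ℚ) :
    ∃ K : ℤ, ∀ (a b : SpecialLinearGroup (Fin 2) ℤ) (u : UpperHalfPlane),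
      (∀ lam : ℚ, toQ a * α * toQ b ≠ lam • (1 : Matrix (Fin 2) (Fin 2) ℚ)) →
      moebius (toQ a * α * toQ b) u = u → IsRootOfForm K u := by
  obtain ⟨N, hN, B, hB⟩ := exists_int_smul_eq_map α
  refine ⟨4 * B.det, fun a b u hns hfix => ?_⟩
  obtain ⟨A, hA⟩ : ∃ A, A = (a : Matrix (Fin 2) (Fin 2) ℤ) * B * b := ⟨_, rfl⟩
  have hAdet : A.det = B.det := by simp [hA]
  have hAg : A.map (fun a => (a : ℚ)) = (N : ℚ) • (toQ a * α * toQ b) := by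
    rw [← Matrix.smul_mul, ← Matrix.mul_smul, ← hB, hA]
    simp only [toQ]
    exact (Matrix.map_mul (f := Int.castRingHom ℚ)).trans
      (congrArg (· * _) (Matrix.map_mul (f := Int.castRingHom ℚ)))
  generalize toQ a * α * toQ b = g at hns hfix hAg
  have hentry : ∀ i j, (A i j : ℚ) = N * g i j := fun i j => congrFun (congrFun hAg i) j
  have hentryC : ∀ i j, (A i j : ℂ) = N * g i j := fun i j => by
    exact_mod_cast congrArg (fun x : ℚ => (x : ℂ)) (hentry i j)
  have hroot : ((A 1 0 : ℤ) : ℂ) * (u : ℂ) ^ 2 + ((A 1 1 - A 0 0 : ℤ) : ℂ) * u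
      + ((-A 0 1 : ℤ) : ℂ) = 0 := by
    push_cast
    simp only [hentryC]
    linear_combination (N : ℂ) * quadratic_of_moebius_eq_self hfix
  rw [det_fin_two] at hAdet
  refine ⟨A 1 0, A 1 1 - A 0 0, -A 0 1, neg_discr_pos_of_root hroot ?_, ?_, hroot⟩
  · rintro ⟨h10, h11, h01⟩
    have hN' : (N : ℚ) ≠ 0 := mod_cast hN
    refine hns (g 0 0) ?_
    have e10 := hentry 1 0
    have e01 := hentry 0 1
    have e11 := hentry 1 1
    rw [h10] at e10
    rw [neg_eq_zero.1 h01] at e01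
    rw [sub_eq_zero.1 h11, hentry 0 0] at e11
    ext i j
    fin_cases i <;> fin_cases j <;> simp_all
  · rw [← hAdet]
    nlinarith [sq_nonneg (A 0 0 + A 1 1)]

theorem toQ_mul (a b : SpecialLinearGroup (Fin 2) ℤ) : toQ (a * b) = toQ a * toQ b := by
  simp only [toQ]
  exact Matrix.map_mul (f := Int.castRingHom ℚ)

theorem toQ_one : toQ 1 = 1 := by
  simp [toQ]

theorem toQ_inv_mul_toQ (γ : SpecialLinearGroup (Fin 2) ℤ) : toQ γ⁻¹ * toQ γ = 1 := by
  rw [← toQ_mul, inv_mul_cancel, toQ_one]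

theorem coe_smul_eq_moebius (γ : SpecialLinearGroup (Fin 2) ℤ) (u : UpperHalfPlane) :
    ((γ • u : UpperHalfPlane) : ℂ) = moebius (toQ γ) u := by
  rw [UpperHalfPlane.coe_specialLinearGroup_apply]
  simp [moebius, toQ]

theorem moebius_mul (g h : Matrix (Fin 2) (Fin 2) ℚ) (z : ℂ)
    (hz : (h 1 0 : ℂ) * z + h 1 1 ≠ 0) :
    moebius (g * h) z = moebius g (moebius h z) := by
  simp only [moebius, Matrix.mul_apply, Fin.sum_univ_two]
  push_cast
  rw [← mul_div_mul_right _ ((g 1 0 : ℂ) * _ + g 1 1) hz]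
  congr 1 <;> field_simp <;> ring

theorem moebius_conj_eq_self {g : Matrix (Fin 2) (Fin 2) ℚ} {u : UpperHalfPlane}
    (h : moebius g u = u) (γ : SpecialLinearGroup (Fin 2) ℤ) :
    moebius (toQ γ * g * toQ γ⁻¹) (γ • u : UpperHalfPlane) = (γ • u : UpperHalfPlane) := by
  rw [moebius_mul _ _ _ (toQ_denom_ne_zero γ⁻¹ _), ← coe_smul_eq_moebius, inv_smul_smul,
    moebius_mul _ _ _ (denom_ne_zero_of_moebius_eq_self h), h, coe_smul_eq_moebius]

/-- A subset of a `G`-set that is stable under a finite-index subgroup `H` and covered by finitely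
many `G`-orbits is a finite union of `H`-orbits. -/
theorem Subgroup.exists_finset_eq_orbits {G X : Type*} [Group G] [MulAction G X]
    (H : Subgroup G) [H.FiniteIndex] {S T : Set X} (hT : T.Finite)
    (hS : ∀ γ ∈ H, ∀ x ∈ S, γ • x ∈ S) (hST : ∀ x ∈ S, ∃ γ : G, ∃ t ∈ T, x = γ • t) :
    ∃ F : Finset X, S = {w | ∃ γ ∈ H, ∃ z ∈ F, w = γ • z} := by
  have hfin : (Set.image2 (fun (c : G ⧸ H) t => c.out⁻¹ • t) Set.univ T ∩ S).Finite :=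
    (Set.finite_univ.image2 _ hT).inter_of_left S
  refine ⟨hfin.toFinset, Set.ext fun x => ⟨fun hx => ?_, ?_⟩⟩
  · obtain ⟨γ, t, ht, rfl⟩ := hST x hx
    have hh : (QuotientGroup.mk γ⁻¹ : G ⧸ H).out⁻¹ * γ⁻¹ ∈ H :=
      QuotientGroup.eq.1 (QuotientGroup.out_eq' _)
    have hz : (QuotientGroup.mk γ⁻¹ : G ⧸ H).out⁻¹ • t =
        ((QuotientGroup.mk γ⁻¹ : G ⧸ H).out⁻¹ * γ⁻¹) • γ • t := by
      rw [mul_smul, inv_smul_smul]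
    refine ⟨_, H.inv_mem hh, (QuotientGroup.mk γ⁻¹ : G ⧸ H).out⁻¹ • t, ?_, ?_⟩
    · refine hfin.mem_toFinset.2 ⟨⟨_, Set.mem_univ _, t, ht, rfl⟩, ?_⟩
      rw [hz]
      exact hS _ hh _ hx
    · rw [hz, inv_smul_smul]
  · rintro ⟨γ, hγ, z, hz, rfl⟩
    exact hS γ hγ z (hfin.mem_toFinset.1 hz).2

/-- If `Γ` is a finite-index subgroup of `SL(2, ℤ)` and
`X = Γα₁Γ ∪ ⋯ ∪ ΓαₙΓ` is a finite union of double cosets of matrices in `GL(2, ℚ)` of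
positive determinant, then the set of points of the upper half-plane fixed by some
non-scalar element of `X` is a finite union of `Γ`-orbits. -/
theorem stmt0 (Γ : Subgroup (Matrix.SpecialLinearGroup (Fin 2) ℤ)) (hΓ : Γ.FiniteIndex)
    (n : ℕ) (α : Fin n → Matrix (Fin 2) (Fin 2) ℚ) (hα : ∀ i, 0 < (α i).det) :
    ∃ F : Finset UpperHalfPlane,
      {u : UpperHalfPlane | ∃ g : Matrix (Fin 2) (Fin 2) ℚ,
          (∃ i : Fin n, ∃ a ∈ Γ, ∃ b ∈ Γ, g = toQ a * α i * toQ b) ∧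
          (∀ lam : ℚ, g ≠ lam • (1 : Matrix (Fin 2) (Fin 2) ℚ)) ∧
          moebius g (u : ℂ) = (u : ℂ)} =
      {w : UpperHalfPlane | ∃ γ ∈ Γ, ∃ z ∈ F, w = γ • z} := by
  choose K hK using fun i => exists_isRootOfForm_of_moebius_eq_self (α i)
  choose T hT hcover using fun i => exists_finite_reps_isRootOfForm (K i)
  refine Γ.exists_finset_eq_orbits (Set.finite_iUnion hT) ?_ ?_
  · rintro γ hγ u ⟨_, ⟨i, a, ha, b, hb, rfl⟩, hns, hfix⟩
    refine ⟨_, ⟨i, γ * a, Γ.mul_mem hγ ha, b * γ⁻¹, Γ.mul_mem hb (Γ.inv_mem hγ), rfl⟩, ?_, ?_⟩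
    · intro lam h
      refine hns lam ?_
      calc toQ a * α i * toQ b
          = (toQ γ⁻¹ * toQ γ) * (toQ a * α i * toQ b) * (toQ γ⁻¹ * toQ γ) := by
            simp [toQ_inv_mul_toQ]
        _ = toQ γ⁻¹ * (toQ (γ * a) * α i * toQ (b * γ⁻¹)) * toQ γ := by
            simp only [toQ_mul, mul_assoc]
        _ = lam • 1 := by simp [h, toQ_inv_mul_toQ]
    · simpa only [toQ_mul, mul_assoc] using moebius_conj_eq_self hfix γ
  · rintro u ⟨_, ⟨i, a, -, b, -, rfl⟩, hns, hfix⟩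
    obtain ⟨γ, t, ht, rfl⟩ := hcover i u (hK i a b u hns hfix)
    exact ⟨γ, t, Set.mem_iUnion.2 ⟨i, ht⟩, rfl⟩
end

section
/- Let Γ and Γ' be finite-index subgroups of SL(2,ℤ) and let α₁, α₂ ∈ GL(2,ℚ) have positive determinant. For i = 1, 2 let Cᵢ ⊆ (Γ\ℍ) × (Γ'\ℍ) be the image of the map ℍ → (Γ\ℍ) × (Γ'\ℍ) sending z to the pair consisting of the Γ-orbit of z and the Γ'-orbit of αᵢ•z. Suppose the double cosets Γ'α₁Γ and Γ'α₂Γ are distinct as subsets of PGL(2,ℚ)⁺, i.e. there exist no γ' ∈ Γ', γ ∈ Γ and nonzero λ ∈ ℚ with α₂ = λ·(γ'·α₁·γ). Then C₁ ∩ C₂ is a finite set. -/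
open Matrix

/-- The curve `C_α ⊆ (Γ\ℍ) × (Γ'\ℍ)`: the image of the map sending `z` to the pair
consisting of the `Γ`-orbit of `z` and the `Γ'`-orbit of `α•z`. -/
def curveC (Γ Γ' : Subgroup (Matrix.SpecialLinearGroup (Fin 2) ℤ))
    (a : Matrix (Fin 2) (Fin 2) ℚ) :
    Set (Quotient (MulAction.orbitRel Γ UpperHalfPlane) ×
      Quotient (MulAction.orbitRel Γ' UpperHalfPlane)) :=
  {q | ∃ z w : UpperHalfPlane, (w : ℂ) = moebius a (z : ℂ) ∧
    q = (Quotient.mk (MulAction.orbitRel Γ UpperHalfPlane) z,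
         Quotient.mk (MulAction.orbitRel Γ' UpperHalfPlane) w)}

open UpperHalfPlane

/-- The integral matrix `A` sends the line through `(z, 1)` into the line through `(w, 1)`. -/
def MapsLine (A : Matrix (Fin 2) (Fin 2) ℤ) (z w : ℂ) : Prop :=
  ∃ μ : ℂ, A.map (Int.cast : ℤ → ℂ) *ᵥ ![z, 1] = μ • ![w, 1]

lemma mapsLine_iff {A : Matrix (Fin 2) (Fin 2) ℤ} {z w : ℂ} :
    MapsLine A z w ↔ A 0 0 * z + A 0 1 = (A 1 0 * z + A 1 1) * w := by
  constructor
  · rintro ⟨μ, h⟩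
    have h0 := congrFun h 0
    have h1 := congrFun h 1
    simp [Matrix.mulVec, dotProduct, Fin.sum_univ_two] at h0 h1
    rw [h0, h1]
  · intro h
    refine ⟨A 1 0 * z + A 1 1, ?_⟩
    ext i
    fin_cases i <;> simp [Matrix.mulVec, dotProduct, Fin.sum_univ_two, h]

lemma MapsLine.mul {A B : Matrix (Fin 2) (Fin 2) ℤ} {z w u : ℂ}
    (hB : MapsLine B w u) (hA : MapsLine A z w) : MapsLine (B * A) z u := by
  obtain ⟨μ, hμ⟩ := hA
  obtain ⟨ν, hν⟩ := hB
  refine ⟨μ * ν, ?_⟩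
  have hmap : (B * A).map (Int.cast : ℤ → ℂ) = B.map Int.cast * A.map Int.cast :=
    Matrix.map_mul (f := Int.castRingHom ℂ)
  rw [hmap, ← Matrix.mulVec_mulVec, hμ, Matrix.mulVec_smul, hν, smul_smul]

lemma MapsLine.adjugate {A : Matrix (Fin 2) (Fin 2) ℤ} {z w : ℂ}
    (hA : MapsLine A z w) : MapsLine A.adjugate w z := by
  rw [mapsLine_iff] at hA ⊢
  simp only [Matrix.adjugate_fin_two, Matrix.of_apply, Matrix.cons_val', Matrix.cons_val_zero,
    Matrix.cons_val_one, Matrix.cons_val_fin_one, Int.cast_neg]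
  linear_combination -hA

lemma mapsLine_smul (g : SpecialLinearGroup (Fin 2) ℤ) (z : ℍ) :
    MapsLine g.1 (z : ℂ) ((g • z : ℍ) : ℂ) := by
  have h : ((g 1 0 : ℤ) : ℂ) * z + ((g 1 1 : ℤ) : ℂ) ≠ 0 := by
    have h := UpperHalfPlane.denom_ne_zero (g : GL (Fin 2) ℝ) z
    simpa [UpperHalfPlane.denom] using h
  rw [mapsLine_iff, UpperHalfPlane.coe_specialLinearGroup_apply]
  simp only [algebraMap_int_eq, eq_intCast, Complex.ofReal_intCast]
  exact (mul_div_cancel₀ _ h).symm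

lemma mapsLine_of_eq_moebius {α : Matrix (Fin 2) (Fin 2) ℚ} {B : Matrix (Fin 2) (Fin 2) ℤ}
    {n : ℤ} (hB : B.map (Int.cast : ℤ → ℚ) = n • α) {z w : ℍ}
    (hw : (w : ℂ) = moebius α z) : MapsLine B z w := by
  have hentry (i j : Fin 2) : (B i j : ℂ) = n * α i j := by
    have h := congrFun (congrFun hB i) j
    simp only [Matrix.map_apply, Matrix.smul_apply, zsmul_eq_mul] at h
    exact_mod_cast congrArg (Rat.cast : ℚ → ℂ) h
  have hden : (α 1 0 : ℂ) * z + α 1 1 ≠ 0 := by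
    intro h
    rw [moebius, h, div_zero] at hw
    exact w.ne_zero hw
  rw [moebius, eq_div_iff hden] at hw
  rw [mapsLine_iff]
  simp only [hentry]
  linear_combination -(n : ℂ) * hw

lemma exists_int_matrix (α : Matrix (Fin 2) (Fin 2) ℚ) :
    ∃ n : ℤ, n ≠ 0 ∧ ∃ B : Matrix (Fin 2) (Fin 2) ℤ, B.map (Int.cast : ℤ → ℚ) = n • α := by
  obtain ⟨⟨n, hn⟩, h⟩ := IsLocalization.exist_integer_multiples_of_finite
    (nonZeroDivisors ℤ) (fun p : Fin 2 × Fin 2 => α p.1 p.2)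
  choose f hf using h
  refine ⟨n, nonZeroDivisors.ne_zero hn, Matrix.of fun i j => f (i, j), ?_⟩
  ext i j
  simpa using hf (i, j)

lemma cast_det_ne_zero {α : Matrix (Fin 2) (Fin 2) ℚ} {B : Matrix (Fin 2) (Fin 2) ℤ} {n : ℤ}
    (hn : n ≠ 0) (hα : 0 < α.det) (hB : B.map (Int.cast : ℤ → ℚ) = n • α) :
    (B.det : ℚ) ≠ 0 := by
  have h : (B.det : ℚ) = (n • α).det := by rw [← hB]; exact Int.cast_det B
  rw [h, ← Int.cast_smul_eq_zsmul ℚ, Matrix.det_smul]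
  exact mul_ne_zero (pow_ne_zero _ (Int.cast_ne_zero.mpr hn)) (ne_of_gt hα)

/-- The points fixed by a nonscalar integral matrix of determinant `N`. -/
def fixedPoints (N : ℤ) : Set ℍ :=
  {z | ∃ A : Matrix (Fin 2) (Fin 2) ℤ, A.det = N ∧ (∀ n : ℤ, A ≠ n • 1) ∧ MapsLine A z z}

lemma smul_mem_fixedPoints {N : ℤ} {z : ℍ} (hz : z ∈ fixedPoints N)
    (g : SpecialLinearGroup (Fin 2) ℤ) : g • z ∈ fixedPoints N := by
  obtain ⟨A, hdet, hA, hAz⟩ := hz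
  have hg : g.1.adjugate * g.1 = 1 := by simp [Matrix.adjugate_mul]
  refine ⟨g.1 * A * g.1.adjugate, ?_, fun n hn => hA n ?_,
    ((mapsLine_smul g z).mul hAz).mul (mapsLine_smul g z).adjugate⟩
  · simp [Matrix.det_mul, Matrix.det_adjugate, hdet]
  · calc A = g.1.adjugate * g.1 * A * (g.1.adjugate * g.1) := by simp [hg]
      _ = g.1.adjugate * (g.1 * A * g.1.adjugate) * g.1 := by simp only [Matrix.mul_assoc]
      _ = n • 1 := by rw [hn, Matrix.mul_smul, Matrix.smul_mul, Matrix.mul_one, hg]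

lemma exists_quadratic_of_mem_fixedPoints {N : ℤ} {z : ℍ} (hz : z ∈ fixedPoints N)
    (hfd : z ∈ ModularGroup.fd) :
    ∃ c ∈ Set.Icc (-2 * N) (2 * N), ∃ e ∈ Set.Icc (-2 * N) (2 * N),
      ∃ b ∈ Set.Icc (-2 * N) (2 * N),
        c ≠ 0 ∧ (c : ℂ) * (z : ℂ) ^ 2 + e * z + b = 0 := by
  obtain ⟨A, hdet, hA, hAz⟩ := hz
  rw [mapsLine_iff] at hAz
  rw [Matrix.det_fin_two] at hdet
  have him := ModularGroup.three_le_four_mul_im_sq_of_mem_fd hfd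
  have hre := abs_le.mp hfd.2
  have hquad : (A 1 0 : ℂ) * (z : ℂ) ^ 2 + (A 1 1 - A 0 0 : ℤ) * z + (-A 0 1 : ℤ) = 0 := by
    push_cast
    linear_combination -hAz
  have hne : A 1 0 ≠ 0 ∨ A 1 1 - A 0 0 ≠ 0 ∨ A 0 1 ≠ 0 := by
    by_contra! h
    refine hA (A 0 0) ?_
    ext i j
    fin_cases i <;> fin_cases j <;> simp [h, sub_eq_zero.mp h.2.1]
  generalize A 1 0 = c at *
  generalize A 0 1 = b at *
  generalize A 0 0 = a at *
  generalize A 1 1 = d at *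
  have hy := z.im_pos
  have hre_eq := congrArg Complex.re hquad
  have him_eq := congrArg Complex.im hquad
  simp [pow_two] at hre_eq him_eq
  set x := z.re
  set y := z.im
  have hlin : (d - a : ℝ) = -2 * c * x := by
    refine mul_right_cancel₀ hy.ne' ?_
    linear_combination him_eq
  have hb : (b : ℝ) = -c * (x ^ 2 + y ^ 2) := by
    linear_combination -hre_eq + x * hlin
  have hdetR : (a * d - b * c : ℝ) = N := by exact_mod_cast hdet
  have hc : c ≠ 0 := by
    rintro rfl
    simp at hlin hb
    have : d - a = 0 := by exact_mod_cast hlin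
    simp_all
  have hcR : (1 : ℝ) ≤ (c : ℝ) ^ 2 := by
    exact_mod_cast Int.one_le_abs (pow_ne_zero 2 hc) |>.trans_eq (abs_of_nonneg (sq_nonneg c))
  have hcy : (c : ℝ) ^ 2 * y ^ 2 ≤ N := by
    have : (N : ℝ) = ((a + d : ℝ) / 2) ^ 2 + c ^ 2 * y ^ 2 := by
      rw [← hdetR, hb]
      linear_combination (-(d - a : ℝ) / 4 + c * x / 2) * hlin
    nlinarith [sq_nonneg ((a + d : ℝ) / 2)]
  have hc2 : 3 * (c : ℝ) ^ 2 ≤ 4 * N := by nlinarith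
  have hx2 : 4 * x ^ 2 ≤ 1 := by nlinarith
  have hc_int : 3 * c ^ 2 ≤ 4 * N := by exact_mod_cast hc2
  have he_int : (d - a) ^ 2 ≤ c ^ 2 := by
    have : (d - a : ℝ) ^ 2 ≤ c ^ 2 := by rw [hlin]; nlinarith
    exact_mod_cast this
  have hbc_int : b ^ 2 ≤ (2 * N) ^ 2 := by
    have h1 : 0 ≤ (c : ℝ) ^ 2 * (x ^ 2 + y ^ 2) := by positivity
    have h2 : (c : ℝ) ^ 2 * (x ^ 2 + y ^ 2) ≤ 2 * N := by nlinarith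
    have h3 : (b : ℝ) ^ 2 ≤ (2 * N) ^ 2 := by
      calc (b : ℝ) ^ 2 ≤ c ^ 2 * b ^ 2 := by nlinarith [sq_nonneg (b : ℝ)]
        _ = (c ^ 2 * (x ^ 2 + y ^ 2)) ^ 2 := by rw [hb]; ring
        _ ≤ _ := by gcongr
    exact_mod_cast h3
  have hN : 0 ≤ 2 * N := by nlinarith [sq_nonneg c]
  have hsq_le (m : ℤ) (hm : 3 * m ^ 2 ≤ 4 * N) : m ∈ Set.Icc (-2 * N) (2 * N) := by
    rw [neg_mul]
    refine abs_le.mp (abs_le_of_sq_le_sq ?_ hN)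
    rcases hN.eq_or_lt with h | h <;> nlinarith
  refine ⟨c, hsq_le c hc_int, d - a, hsq_le _ (by linarith), -b, ?_, hc, hquad⟩
  rw [neg_mul]
  exact abs_le.mp (abs_le_of_sq_le_sq (by simpa using hbc_int) hN)

lemma finite_fixedPoints_inter_fd (N : ℤ) : (fixedPoints N ∩ ModularGroup.fd).Finite := by
  have hroots (c e b : ℤ) : {z : ℍ | c ≠ 0 ∧ (c : ℂ) * (z : ℂ) ^ 2 + e * z + b = 0}.Finite := by
    by_cases hc : c = 0
    · simp [hc]
    have hp : (.C (c : ℂ) * .X ^ 2 + .C (e : ℂ) * .X + .C (b : ℂ) : Polynomial ℂ) ≠ 0 := by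
      refine Polynomial.ne_zero_of_natDegree_gt (n := 1) ?_
      rw [Polynomial.natDegree_quadratic (Int.cast_ne_zero.mpr hc)]
      exact one_lt_two
    refine ((Polynomial.finite_setOfPred_isRoot hp).preimage
      UpperHalfPlane.coe_injective.injOn).subset fun z hz => ?_
    simpa [Polynomial.IsRoot] using hz.2
  have hI := Set.finite_Icc (-2 * N) (2 * N)
  refine (hI.biUnion fun c _ => hI.biUnion fun e _ => hI.biUnion fun b _ =>
    hroots c e b).subset fun z hz => ?_
  obtain ⟨c, hc, e, he, b, hb, h⟩ := exists_quadratic_of_mem_fixedPoints hz.1 hz.2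
  simp only [Set.mem_iUnion]
  exact ⟨c, hc, e, he, b, hb, h⟩

lemma finite_image_mk_fixedPoints (Γ : Subgroup (SpecialLinearGroup (Fin 2) ℤ))
    [Γ.FiniteIndex] (N : ℤ) :
    (Quotient.mk (MulAction.orbitRel Γ ℍ) '' fixedPoints N).Finite := by
  refine ((Set.finite_univ (α := SpecialLinearGroup (Fin 2) ℤ ⧸ Γ)).image2
    (fun q z => Quotient.mk (MulAction.orbitRel Γ ℍ) (q.out⁻¹ • z))
    (finite_fixedPoints_inter_fd N)).subset ?_
  rintro _ ⟨z, hz, rfl⟩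
  obtain ⟨g, hg⟩ := ModularGroup.exists_smul_mem_fd z
  refine ⟨(g : SpecialLinearGroup (Fin 2) ℤ ⧸ Γ), trivial, g • z,
    ⟨smul_mem_fixedPoints hz g, hg⟩, Quotient.sound ?_⟩
  obtain ⟨γ, hγ⟩ := QuotientGroup.mk_out_eq_mul Γ g
  refine ⟨γ⁻¹, ?_⟩
  rw [hγ, smul_smul, _root_.mul_inv_rev, inv_mul_cancel_right]
  rfl

lemma mem_fixedPoints_of_correspondences {B₁ B₂ : Matrix (Fin 2) (Fin 2) ℤ}
    {γ γ' : SpecialLinearGroup (Fin 2) ℤ} {z w : ℍ} (h₁ : MapsLine B₁ z w)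
    (h₂ : MapsLine B₂ (γ • z : ℍ) (γ' • w : ℍ))
    (hne : ∀ n : ℤ, n • B₁ ≠ B₁.det • (γ'.1.adjugate * B₂ * γ.1)) :
    z ∈ fixedPoints (B₁.det * B₂.det) ∧ w ∈ fixedPoints (B₁.det * B₂.det) := by
  have hM : MapsLine (γ'.1.adjugate * B₂ * γ.1) z w :=
    ((mapsLine_smul γ' w).adjugate.mul h₂).mul (mapsLine_smul γ z)
  have hdet : (γ'.1.adjugate * B₂ * γ.1).det = B₂.det := by
    simp [Matrix.det_adjugate]
  generalize γ'.1.adjugate * B₂ * γ.1 = M at *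
  refine ⟨⟨B₁.adjugate * M, ?_, fun n hn => hne n ?_, h₁.adjugate.mul hM⟩,
    ⟨M * B₁.adjugate, ?_, fun n hn => hne n ?_, hM.mul h₁.adjugate⟩⟩
  · simp [Matrix.det_adjugate, hdet]
  · calc n • B₁ = B₁ * (B₁.adjugate * M) := by rw [hn, Matrix.mul_smul, Matrix.mul_one]
      _ = B₁.det • M := by
        rw [← Matrix.mul_assoc, Matrix.mul_adjugate, Matrix.smul_mul, Matrix.one_mul]
  · simp [Matrix.det_adjugate, hdet, mul_comm]
  · calc n • B₁ = M * B₁.adjugate * B₁ := by rw [hn, Matrix.smul_mul, Matrix.one_mul]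
      _ = B₁.det • M := by
        rw [Matrix.mul_assoc, Matrix.adjugate_mul, Matrix.mul_smul, Matrix.mul_one]

/-- If the double cosets `Γ'α₁Γ` and `Γ'α₂Γ` are distinct in `PGL(2,ℚ)⁺`,
then the corresponding curves `C₁, C₂ ⊆ (Γ\ℍ) × (Γ'\ℍ)` meet in only finitely many points. -/
theorem stmt3 (Γ Γ' : Subgroup (Matrix.SpecialLinearGroup (Fin 2) ℤ))
    (hΓ : Γ.FiniteIndex) (hΓ' : Γ'.FiniteIndex)
    (α₁ α₂ : Matrix (Fin 2) (Fin 2) ℚ) (h₁ : 0 < α₁.det) (h₂ : 0 < α₂.det)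
    (hdistinct : ¬ ∃ γ' ∈ Γ', ∃ γ ∈ Γ, ∃ lam : ℚ, lam ≠ 0 ∧
      α₂ = lam • (toQ γ' * α₁ * toQ γ)) :
    (curveC Γ Γ' α₁ ∩ curveC Γ Γ' α₂).Finite := by
  obtain ⟨n₁, hn₁, B₁, hB₁⟩ := exists_int_matrix α₁
  obtain ⟨n₂, hn₂, B₂, hB₂⟩ := exists_int_matrix α₂
  refine ((finite_image_mk_fixedPoints Γ (B₁.det * B₂.det)).prod
    (finite_image_mk_fixedPoints Γ' (B₁.det * B₂.det))).subset ?_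
  rintro _ ⟨⟨z, w, hw, rfl⟩, z₂, w₂, hw₂, hq⟩
  obtain ⟨hqz, hqw⟩ := Prod.ext_iff.mp hq
  obtain ⟨⟨γ, hγ⟩, hγz⟩ := Quotient.exact hqz.symm
  obtain ⟨⟨γ', hγ'⟩, hγw⟩ := Quotient.exact hqw.symm
  obtain rfl : γ • z = z₂ := hγz
  obtain rfl : γ' • w = w₂ := hγw
  suffices hne : ∀ n : ℤ, n • B₁ ≠ B₁.det • (γ'.1.adjugate * B₂ * γ.1) by
    obtain ⟨hz, hw⟩ := mem_fixedPoints_of_correspondences (mapsLine_of_eq_moebius hB₁ hw)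
      (mapsLine_of_eq_moebius hB₂ hw₂) hne
    exact ⟨⟨z, hz, rfl⟩, w, hw, rfl⟩
  intro n hn
  have hB : n • (γ'.1 * B₁ * γ⁻¹.1) = B₁.det • B₂ := by
    have hg : γ.1 * γ.1.adjugate = 1 := by simp [Matrix.mul_adjugate]
    have hg' : γ'.1 * γ'.1.adjugate = 1 := by simp [Matrix.mul_adjugate]
    calc n • (γ'.1 * B₁ * γ⁻¹.1) = γ'.1 * (n • B₁) * γ.1.adjugate := by
          rw [Matrix.mul_smul, Matrix.smul_mul]; rfl
      _ = B₁.det • ((γ'.1 * γ'.1.adjugate) * B₂ * (γ.1 * γ.1.adjugate)) := by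
          rw [hn]; simp only [Matrix.mul_smul, Matrix.smul_mul, Matrix.mul_assoc]
      _ = _ := by simp [hg, hg']
  have hα : ((n : ℚ) * n₁) • (toQ γ' * α₁ * toQ γ⁻¹) = ((B₁.det : ℚ) * n₂) • α₂ := by
    have h := congrArg (Int.castRingHom ℚ).mapMatrix hB
    simp only [map_zsmul, map_mul] at h
    simp only [RingHom.mapMatrix_apply, Int.coe_castRingHom, hB₁, hB₂] at h
    simpa only [toQ, mul_smul, Int.cast_smul_eq_zsmul, Matrix.mul_smul, Matrix.smul_mul] using h
  have hd : (B₁.det : ℚ) * n₂ ≠ 0 :=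
    mul_ne_zero (cast_det_ne_zero hn₁ h₁ hB₁) (Int.cast_ne_zero.mpr hn₂)
  refine hdistinct ⟨γ', hγ', γ⁻¹, Γ.inv_mem hγ, ((B₁.det : ℚ) * n₂)⁻¹ * (n * n₁), ?_, ?_⟩
  · refine mul_ne_zero (inv_ne_zero hd) fun h => h₂.ne' ?_
    rw [h, zero_smul] at hα
    rw [(smul_eq_zero.mp hα.symm).resolve_left hd]
    simp
  · rw [mul_smul, hα, inv_smul_smul₀ hd]
end

section
/- Let p be a prime and let k be a nonzero element of ℤ/pℤ. In SL(2, ℤ/pℤ), let B denote the subgroup of lower-triangular matrices (those whose upper-right entry is 0), and let t = (1, k; 0, 1). Then B ∩ t⁻¹·B·t = { (u⁻¹, 0; k⁻¹·(u − u⁻¹), u) : u ∈ (ℤ/pℤ)ˣ }; in particular this intersection is a maximal torus in SL(2, ℤ/pℤ) of order p − 1. -/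
open Matrix

/-- The upper-right entry of `t * g * t⁻¹`, for `t = (1, k; 0, 1)`. -/
theorem conj_upper_apply_zero_one {R : Type*} [CommRing R] {k : R}
    {t : Matrix.SpecialLinearGroup (Fin 2) R}
    (ht : (t : Matrix (Fin 2) (Fin 2) R) = !![1, k; 0, 1])
    (g : Matrix.SpecialLinearGroup (Fin 2) R) :
    (t * g * t⁻¹ : Matrix.SpecialLinearGroup (Fin 2) R).1 0 1 =
      g.1 0 1 + k * (g.1 1 1 - g.1 0 0 - k * g.1 1 0) := by
  simp [Matrix.SpecialLinearGroup.coe_mul, Matrix.SpecialLinearGroup.coe_inv, ht,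
    Matrix.adjugate_fin_two, Matrix.mul_apply, Fin.sum_univ_two, Matrix.vecMul, dotProduct]
  ring

/-- The matrix `(u⁻¹, 0; k⁻¹(u − u⁻¹), u)` of determinant one. -/
def lowerTorus {F : Type*} [Field F] (k : F) (u : Fˣ) : Matrix.SpecialLinearGroup (Fin 2) F :=
  ⟨!![(u : F)⁻¹, 0; k⁻¹ * ((u : F) - (u : F)⁻¹), (u : F)], by simp [Matrix.det_fin_two]⟩

theorem lowerTorus_injective {F : Type*} [Field F] (k : F) :
    Function.Injective (lowerTorus k) := by
  intro u v h
  have h11 := congrArg (fun g : Matrix.SpecialLinearGroup (Fin 2) F => g.1 1 1) h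
  exact Units.ext (by simpa [lowerTorus] using h11)

theorem lower_inter_conj_eq_range {F : Type*} [Field F] {k : F} (hk : k ≠ 0)
    {t : Matrix.SpecialLinearGroup (Fin 2) F}
    (ht : (t : Matrix (Fin 2) (Fin 2) F) = !![1, k; 0, 1]) :
    ({g : Matrix.SpecialLinearGroup (Fin 2) F | g.1 0 1 = 0} ∩
      {g | ∃ b : Matrix.SpecialLinearGroup (Fin 2) F, b.1 0 1 = 0 ∧ g = t⁻¹ * b * t}) =
      Set.range (lowerTorus k) := by
  ext g
  constructor
  · rintro ⟨h01 : g.1 0 1 = 0, b, hb, hg⟩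
    have hb' : b = t * g * t⁻¹ := by rw [hg]; group
    rw [hb', conj_upper_apply_zero_one ht, h01, zero_add] at hb
    have hc : g.1 1 1 - g.1 0 0 = k * g.1 1 0 :=
      sub_eq_zero.mp ((mul_eq_zero.mp hb).resolve_left hk)
    have hdet : g.1 0 0 * g.1 1 1 = 1 := by
      have := g.2
      rwa [Matrix.det_fin_two, h01, zero_mul, sub_zero] at this
    have hinv : (g.1 1 1)⁻¹ = g.1 0 0 := inv_eq_of_mul_eq_one_left hdet
    refine ⟨Units.mk0 (g.1 1 1) (right_ne_zero_of_mul_eq_one hdet), Subtype.ext ?_⟩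
    ext i j
    fin_cases i <;> fin_cases j <;> simp [lowerTorus, hinv, h01, hc, hk]
  · rintro ⟨u, rfl⟩
    refine ⟨rfl, t * lowerTorus k u * t⁻¹, ?_, by group⟩
    rw [conj_upper_apply_zero_one ht]
    simp [lowerTorus, hk]

/-- In `SL(2, ℤ/pℤ)`, for `k ≠ 0` and `t = (1, k; 0, 1)`, the intersection
`B ∩ t⁻¹·B·t` of the lower-triangular Borel with its conjugate by `t` is the torus
`{(u⁻¹, 0; k⁻¹(u − u⁻¹), u) : u ∈ (ℤ/pℤ)ˣ}`, of order `p − 1`. -/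
theorem stmt5 (p : ℕ) [Fact p.Prime] (k : ZMod p) (hk : k ≠ 0)
    (t : Matrix.SpecialLinearGroup (Fin 2) (ZMod p))
    (ht : (t : Matrix (Fin 2) (Fin 2) (ZMod p)) = !![1, k; 0, 1]) :
    ({g : Matrix.SpecialLinearGroup (Fin 2) (ZMod p) |
        (g : Matrix (Fin 2) (Fin 2) (ZMod p)) 0 1 = 0} ∩
      {g | ∃ b : Matrix.SpecialLinearGroup (Fin 2) (ZMod p),
        (b : Matrix (Fin 2) (Fin 2) (ZMod p)) 0 1 = 0 ∧ g = t⁻¹ * b * t}) =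
      {g : Matrix.SpecialLinearGroup (Fin 2) (ZMod p) |
        ∃ u : (ZMod p)ˣ, (g : Matrix (Fin 2) (Fin 2) (ZMod p)) =
          !![((u : ZMod p))⁻¹, 0; k⁻¹ * ((u : ZMod p) - ((u : ZMod p))⁻¹), (u : ZMod p)]} ∧
    Set.ncard ({g : Matrix.SpecialLinearGroup (Fin 2) (ZMod p) |
        (g : Matrix (Fin 2) (Fin 2) (ZMod p)) 0 1 = 0} ∩
      {g | ∃ b : Matrix.SpecialLinearGroup (Fin 2) (ZMod p),
        (b : Matrix (Fin 2) (Fin 2) (ZMod p)) 0 1 = 0 ∧ g = t⁻¹ * b * t}) = p - 1 := by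
  have hB := lower_inter_conj_eq_range hk ht
  rw [hB]
  refine ⟨?_, ?_⟩
  · ext g
    exact exists_congr fun u => eq_comm.trans Subtype.ext_iff
  · rw [← Set.image_univ, Set.ncard_image_of_injective _ (lowerTorus_injective k),
      Set.ncard_univ, Nat.card_eq_fintype_card, ZMod.card_units]
end

section
/- Let p be a prime and let j ≥ 1 be an integer. In SL(2, ℚ_p), the double coset K·diag(p^(−j), p^(j))·K is equal to the union of the four U-double cosets U·w·U, where w ranges over the four matrices diag(p^(−j), p^(j)), (0, −p^(−j); p^(j), 0), diag(p^(j), p^(−j)), and (0, −p^(j); p^(−j), 0); moreover these four U-double cosets are pairwise disjoint. -/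
open Matrix

/-- `K = SL(2, ℤ_p)`: determinant-one 2×2 matrices over `ℚ_p` with `p`-integral entries. -/
def Kset (p : ℕ) [Fact p.Prime] : Set (Matrix (Fin 2) (Fin 2) ℚ_[p]) :=
  {g | g.det = 1 ∧ ∀ i j, ‖g i j‖ ≤ 1}

/-- The lower-triangular Iwahori subgroup `U ⊆ K`: the upper-right entry has valuation ≥ 1. -/
def Uset (p : ℕ) [Fact p.Prime] : Set (Matrix (Fin 2) (Fin 2) ℚ_[p]) :=
  {g | g ∈ Kset p ∧ ‖g 0 1‖ ≤ ((p : ℝ))⁻¹}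

/-- The double coset `A·g·B` of 2×2 matrices over `ℚ_p`. -/
def DCp (p : ℕ) [Fact p.Prime] (A : Set (Matrix (Fin 2) (Fin 2) ℚ_[p]))
    (g : Matrix (Fin 2) (Fin 2) ℚ_[p]) (B : Set (Matrix (Fin 2) (Fin 2) ℚ_[p])) :
    Set (Matrix (Fin 2) (Fin 2) ℚ_[p]) :=
  {m | ∃ a ∈ A, ∃ b ∈ B, m = a * g * b}

/-- The four Iwahori double coset representatives appearing in Statement 6. -/
noncomputable def wmat (p : ℕ) [Fact p.Prime] (j : ℕ) :
    Fin 4 → Matrix (Fin 2) (Fin 2) ℚ_[p] :=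
  ![!![(p : ℚ_[p]) ^ (-(j : ℤ)), 0; 0, (p : ℚ_[p]) ^ (j : ℤ)],
    !![0, -(p : ℚ_[p]) ^ (-(j : ℤ)); (p : ℚ_[p]) ^ (j : ℤ), 0],
    !![(p : ℚ_[p]) ^ (j : ℤ), 0; 0, (p : ℚ_[p]) ^ (-(j : ℤ))],
    !![0, -(p : ℚ_[p]) ^ (j : ℤ); (p : ℚ_[p]) ^ (-(j : ℤ)), 0]]

section Helpers

variable {p : ℕ} [Fact p.Prime]

theorem Padic.norm_add_lt_one {x y : ℚ_[p]} (hx : ‖x‖ < 1) (hy : ‖y‖ < 1) : ‖x + y‖ < 1 :=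
  (Padic.nonarchimedean x y).trans_lt (max_lt hx hy)

theorem Padic.norm_add_le_one {x y : ℚ_[p]} (hx : ‖x‖ ≤ 1) (hy : ‖y‖ ≤ 1) : ‖x + y‖ ≤ 1 :=
  (Padic.nonarchimedean x y).trans (max_le hx hy)

theorem Padic.norm_mul_le_one {x y : ℚ_[p]} (hx : ‖x‖ ≤ 1) (hy : ‖y‖ ≤ 1) : ‖x * y‖ ≤ 1 := by
  rw [norm_mul]; exact mul_le_one₀ hx (norm_nonneg _) hy

theorem Padic.norm_mul_lt_one_of_lt_of_le {x y : ℚ_[p]} (hx : ‖x‖ < 1) (hy : ‖y‖ ≤ 1) :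
    ‖x * y‖ < 1 := by
  rw [norm_mul]; exact mul_lt_one_of_nonneg_of_lt_one_left (norm_nonneg _) hx hy

theorem Padic.norm_mul_lt_one_of_le_of_lt {x y : ℚ_[p]} (hx : ‖x‖ ≤ 1) (hy : ‖y‖ < 1) :
    ‖x * y‖ < 1 := by
  rw [mul_comm]; exact norm_mul_lt_one_of_lt_of_le hy hx

theorem Padic.norm_add_eq_one {x y : ℚ_[p]} (hx : ‖x‖ = 1) (hy : ‖y‖ < 1) : ‖x + y‖ = 1 := by
  rw [Padic.add_eq_max_of_ne (by rw [hx]; exact hy.ne'), hx, max_eq_left hy.le]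

theorem Padic.norm_le_inv_of_lt_one {x : ℚ_[p]} (hx : ‖x‖ < 1) : ‖x‖ ≤ (p : ℝ)⁻¹ := by
  simpa using (Padic.norm_le_pow_iff_norm_lt_pow_add_one x (-1)).2 (by simpa using hx)

theorem inv_natCast_prime_lt_one : (p : ℝ)⁻¹ < 1 :=
  inv_lt_one_of_one_lt₀ (by exact_mod_cast (Fact.out : p.Prime).one_lt)

theorem Kset_mul {g h : Matrix (Fin 2) (Fin 2) ℚ_[p]} (hg : g ∈ Kset p) (hh : h ∈ Kset p) :
    g * h ∈ Kset p := by
  refine ⟨by rw [det_mul, hg.1, hh.1, one_mul], fun i k => ?_⟩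
  rw [mul_apply, Fin.sum_univ_two]
  exact Padic.norm_add_le_one (Padic.norm_mul_le_one (hg.2 _ _) (hh.2 _ _))
    (Padic.norm_mul_le_one (hg.2 _ _) (hh.2 _ _))

theorem mem_Kset_of {a b c d : ℚ_[p]} (hdet : a * d - b * c = 1) (ha : ‖a‖ ≤ 1) (hb : ‖b‖ ≤ 1)
    (hc : ‖c‖ ≤ 1) (hd : ‖d‖ ≤ 1) : !![a, b; c, d] ∈ Kset p := by
  refine ⟨by rw [det_fin_two_of, hdet], fun i k => ?_⟩
  fin_cases i <;> fin_cases k <;> simpa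

theorem mem_Uset_of {a b c d : ℚ_[p]} (hdet : a * d - b * c = 1) (ha : ‖a‖ ≤ 1) (hb : ‖b‖ < 1)
    (hc : ‖c‖ ≤ 1) (hd : ‖d‖ ≤ 1) : !![a, b; c, d] ∈ Uset p :=
  ⟨mem_Kset_of hdet ha hb.le hc hd, by simpa using Padic.norm_le_inv_of_lt_one hb⟩

theorem Uset_norm_upper_right_lt_one {u : Matrix (Fin 2) (Fin 2) ℚ_[p]} (hu : u ∈ Uset p) :
    ‖u 0 1‖ < 1 :=
  hu.2.trans_lt inv_natCast_prime_lt_one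

theorem Uset_norm_diag {u : Matrix (Fin 2) (Fin 2) ℚ_[p]} (hu : u ∈ Uset p) :
    ‖u 0 0‖ = 1 ∧ ‖u 1 1‖ = 1 := by
  have hdet := hu.1.1
  rw [det_fin_two] at hdet
  have h : ‖u 0 0 * u 1 1‖ = 1 := by
    rw [show u 0 0 * u 1 1 = 1 + u 0 1 * u 1 0 by linear_combination hdet]
    exact Padic.norm_add_eq_one norm_one
      (Padic.norm_mul_lt_one_of_lt_of_le (Uset_norm_upper_right_lt_one hu) (hu.1.2 _ _))
  constructor <;> refine le_antisymm (hu.1.2 _ _) (not_lt.1 fun hlt => h.not_lt ?_)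
  · exact Padic.norm_mul_lt_one_of_lt_of_le hlt (hu.1.2 _ _)
  · exact Padic.norm_mul_lt_one_of_le_of_lt (hu.1.2 _ _) hlt

/-- The four Weyl-type representatives attached to a scalar `q`. -/
noncomputable def weylRep (q : ℚ_[p]) : Fin 4 → Matrix (Fin 2) (Fin 2) ℚ_[p] :=
  ![!![q⁻¹, 0; 0, q], !![0, -q⁻¹; q, 0], !![q, 0; 0, q⁻¹], !![0, -q; q⁻¹, 0]]

theorem wmat_eq_weylRep (j : ℕ) : wmat p j = weylRep ((p : ℚ_[p]) ^ j) := by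
  simp [wmat, weylRep]

/-- The position of the pivot of a matrix modulo `p`, with respect to the action of lower
triangular matrices on both sides. -/
def HasPivot (m : Matrix (Fin 2) (Fin 2) ℚ_[p]) : Fin 4 → Prop :=
  ![‖m 0 0‖ = 1 ∧ ‖m 0 1‖ < 1,
    ‖m 0 1‖ = 1,
    ‖m 0 0‖ < 1 ∧ ‖m 0 1‖ < 1 ∧ ‖m 1 1‖ = 1,
    ‖m 0 0‖ < 1 ∧ ‖m 0 1‖ < 1 ∧ ‖m 1 1‖ < 1 ∧ ‖m 1 0‖ = 1]

theorem HasPivot.unique {m : Matrix (Fin 2) (Fin 2) ℚ_[p]} {i k : Fin 4}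
    (hi : HasPivot m i) (hk : HasPivot m k) : i = k := by
  fin_cases i <;> fin_cases k <;> simp [HasPivot] at hi hk ⊢ <;> linarith

theorem exists_hasPivot {m : Matrix (Fin 2) (Fin 2) ℚ_[p]} (hm : ∀ i k, ‖m i k‖ ≤ 1)
    (hunit : ∃ i k, ‖m i k‖ = 1) : ∃ i, HasPivot m i := by
  rcases (hm 0 1).eq_or_lt with h01 | h01
  · exact ⟨1, h01⟩
  rcases (hm 0 0).eq_or_lt with h00 | h00
  · exact ⟨0, h00, h01⟩
  rcases (hm 1 1).eq_or_lt with h11 | h11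
  · exact ⟨2, h00, h01, h11⟩
  refine ⟨3, h00, h01, h11, ?_⟩
  obtain ⟨i, k, hik⟩ := hunit
  fin_cases i <;> fin_cases k <;> simp at hik <;> first | exact hik | linarith

theorem hasPivot_of_mem_DCp_Uset {q : ℚ_[p]} (hq0 : q ≠ 0) (hq : ‖q‖ < 1) {i : Fin 4}
    {m : Matrix (Fin 2) (Fin 2) ℚ_[p]} (hm : m ∈ DCp p (Uset p) (weylRep q i) (Uset p)) :
    HasPivot (q • m) i := by
  obtain ⟨u, hu, v, hv, rfl⟩ := hm
  have hu01 := Uset_norm_upper_right_lt_one hu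
  have hv01 := Uset_norm_upper_right_lt_one hv
  obtain ⟨hu00, hu11⟩ := Uset_norm_diag hu
  obtain ⟨hv00, hv11⟩ := Uset_norm_diag hv
  have hqq : ‖q ^ 2‖ < 1 := by
    rw [norm_pow]; exact pow_lt_one₀ (norm_nonneg _) hq two_ne_zero
  have small (x y : ℚ_[p]) (hx : ‖x‖ ≤ 1) (hy : ‖y‖ ≤ 1) : ‖q ^ 2 * (x * y)‖ < 1 :=
    Padic.norm_mul_lt_one_of_lt_of_le hqq (Padic.norm_mul_le_one hx hy)
  have small' (x y : ℚ_[p]) (hx : ‖x‖ ≤ 1) (hy : ‖y‖ ≤ 1) : ‖-(q ^ 2 * (x * y))‖ < 1 := by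
    rw [norm_neg]; exact small x y hx hy
  have unit (x y : ℚ_[p]) (hx : ‖x‖ = 1) (hy : ‖y‖ = 1) : ‖x * y‖ = 1 := by
    rw [norm_mul, hx, hy, one_mul]
  have e0 (r s : Fin 2) : (q • (u * weylRep q 0 * v)) r s
      = u r 0 * v 0 s + q ^ 2 * (u r 1 * v 1 s) := by
    simp [weylRep, mul_apply, Fin.sum_univ_two]; field_simp
  have e1 (r s : Fin 2) : (q • (u * weylRep q 1 * v)) r s
      = -(u r 0 * v 1 s) + q ^ 2 * (u r 1 * v 0 s) := by
    simp [weylRep, mul_apply, Fin.sum_univ_two]; field_simp; ring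
  have e2 (r s : Fin 2) : (q • (u * weylRep q 2 * v)) r s
      = u r 1 * v 1 s + q ^ 2 * (u r 0 * v 0 s) := by
    simp [weylRep, mul_apply, Fin.sum_univ_two]; field_simp; ring
  have e3 (r s : Fin 2) : (q • (u * weylRep q 3 * v)) r s
      = u r 1 * v 0 s + -(q ^ 2 * (u r 0 * v 1 s)) := by
    simp [weylRep, mul_apply, Fin.sum_univ_two]; field_simp
  have hu' := hu.1.2
  have hv' := hv.1.2
  fin_cases i
  · refine ⟨?_, ?_⟩ <;> erw [e0]
    · exact Padic.norm_add_eq_one (unit _ _ hu00 hv00) (small _ _ (hu' _ _) (hv' _ _))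
    · exact Padic.norm_add_lt_one (Padic.norm_mul_lt_one_of_le_of_lt (hu' _ _) hv01)
        (small _ _ (hu' _ _) (hv' _ _))
  · change ‖_‖ = 1
    erw [e1]
    exact Padic.norm_add_eq_one (by rw [norm_neg]; exact unit _ _ hu00 hv11)
      (small _ _ (hu' _ _) (hv' _ _))
  · refine ⟨?_, ?_, ?_⟩ <;> erw [e2]
    · exact Padic.norm_add_lt_one (Padic.norm_mul_lt_one_of_lt_of_le hu01 (hv' _ _))
        (small _ _ (hu' _ _) (hv' _ _))
    · exact Padic.norm_add_lt_one (Padic.norm_mul_lt_one_of_lt_of_le hu01 (hv' _ _))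
        (small _ _ (hu' _ _) (hv' _ _))
    · exact Padic.norm_add_eq_one (unit _ _ hu11 hv11) (small _ _ (hu' _ _) (hv' _ _))
  · refine ⟨?_, ?_, ?_, ?_⟩ <;> erw [e3]
    · exact Padic.norm_add_lt_one (Padic.norm_mul_lt_one_of_lt_of_le hu01 (hv' _ _))
        (small' _ _ (hu' _ _) (hv' _ _))
    · exact Padic.norm_add_lt_one (Padic.norm_mul_lt_one_of_lt_of_le hu01 (hv' _ _))
        (small' _ _ (hu' _ _) (hv' _ _))
    · exact Padic.norm_add_lt_one (Padic.norm_mul_lt_one_of_le_of_lt (hu' _ _) hv01)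
        (small' _ _ (hu' _ _) (hv' _ _))
    · exact Padic.norm_add_eq_one (unit _ _ hu11 hv00) (small' _ _ (hu' _ _) (hv' _ _))

theorem mem_DCp_Uset_of_hasPivot {q : ℚ_[p]} (hq0 : q ≠ 0) {i : Fin 4}
    {m : Matrix (Fin 2) (Fin 2) ℚ_[p]} (hdet : m.det = 1) (hint : ∀ r s, ‖(q • m) r s‖ ≤ 1)
    (hpiv : HasPivot (q • m) i) : m ∈ DCp p (Uset p) (weylRep q i) (Uset p) := by
  obtain ⟨a, b, c, d, rfl⟩ : ∃ a b c d, m = !![a, b; c, d] := ⟨_, _, _, _, eta_fin_two m⟩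
  rw [det_fin_two_of] at hdet
  have ha : ‖q * a‖ ≤ 1 := hint 0 0
  have hb : ‖q * b‖ ≤ 1 := hint 0 1
  have hc : ‖q * c‖ ≤ 1 := hint 1 0
  have hd : ‖q * d‖ ≤ 1 := hint 1 1
  have ne_zero {x : ℚ_[p]} (hx : ‖q * x‖ = 1) : x ≠ 0 := by
    rintro rfl; simp at hx
  have norm_ratio {x : ℚ_[p]} (hx : ‖q * x‖ = 1) (y : ℚ_[p]) : ‖y / x‖ = ‖q * y‖ := by
    rw [← mul_div_mul_left y x hq0, norm_div, hx, div_one]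
  have norm_inverse {x : ℚ_[p]} (hx : ‖q * x‖ = 1) : ‖(q * x)⁻¹‖ ≤ 1 := by
    rw [norm_inv, hx, inv_one]
  fin_cases i
  · obtain ⟨h00, h01⟩ : ‖q * a‖ = 1 ∧ ‖q * b‖ < 1 := hpiv
    have h := ne_zero h00
    refine ⟨!![1, 0; c / a, 1], mem_Uset_of (by ring) (by simp) (by simp)
      (by rwa [norm_ratio h00]) (by simp), !![q * a, q * b; 0, (q * a)⁻¹],
      mem_Uset_of (by field_simp; ring) ha h01 (by simp) (norm_inverse h00), ?_⟩
    ext r s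
    fin_cases r <;> fin_cases s <;> simp [weylRep, mul_apply, Fin.sum_univ_two] <;>
      field_simp
    linear_combination hdet
  · have h01 : ‖q * b‖ = 1 := hpiv
    have h := ne_zero h01
    refine ⟨!![1, 0; d / b, 1], mem_Uset_of (by ring) (by simp) (by simp)
      (by rwa [norm_ratio h01]) (by simp), !![-(q * b)⁻¹, 0; -(q * a), -(q * b)],
      mem_Uset_of (by field_simp; ring) (by rw [norm_neg]; exact norm_inverse h01) (by simp)
        (by rwa [norm_neg]) (by rwa [norm_neg]), ?_⟩
    ext r s
    fin_cases r <;> fin_cases s <;> simp [weylRep, mul_apply, Fin.sum_univ_two] <;>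
      field_simp
    linear_combination -hdet
  · obtain ⟨-, h01, h11⟩ : ‖q * a‖ < 1 ∧ ‖q * b‖ < 1 ∧ ‖q * d‖ = 1 := hpiv
    have h := ne_zero h11
    refine ⟨!![1, b / d; 0, 1], mem_Uset_of (by ring) (by simp) (by rwa [norm_ratio h11])
      (by simp) (by simp), !![(q * d)⁻¹, 0; q * c, q * d],
      mem_Uset_of (by field_simp; ring) (norm_inverse h11) (by simp) hc hd, ?_⟩
    ext r s
    fin_cases r <;> fin_cases s <;> simp [weylRep, mul_apply, Fin.sum_univ_two] <;>
      field_simp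
    linear_combination hdet
  · obtain ⟨h00, -, h11, h10⟩ :
      ‖q * a‖ < 1 ∧ ‖q * b‖ < 1 ∧ ‖q * d‖ < 1 ∧ ‖q * c‖ = 1 := hpiv
    have h := ne_zero h10
    refine ⟨!![1, a / c; 0, 1], mem_Uset_of (by ring) (by simp) (by rwa [norm_ratio h10])
      (by simp) (by simp), !![q * c, q * d; 0, (q * c)⁻¹],
      mem_Uset_of (by field_simp; ring) hc h11 (by simp) (norm_inverse h10), ?_⟩
    ext r s
    fin_cases r <;> fin_cases s <;> simp [weylRep, mul_apply, Fin.sum_univ_two] <;>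
      field_simp
    linear_combination -hdet

theorem DCp_Uset_subset_DCp_Kset (q : ℚ_[p]) (i : Fin 4) :
    DCp p (Uset p) (weylRep q i) (Uset p) ⊆ DCp p (Kset p) !![q⁻¹, 0; 0, q] (Kset p) := by
  rintro m ⟨u, hu, v, hv, rfl⟩
  have h1 : (1 : Matrix (Fin 2) (Fin 2) ℚ_[p]) ∈ Kset p := by
    rw [one_fin_two]; exact mem_Kset_of (by simp) (by simp) (by simp) (by simp) (by simp)
  have hs : !![0, -1; 1, 0] ∈ Kset p :=
    mem_Kset_of (by simp) (by simp) (by simp) (by simp) (by simp)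
  have hs' : !![0, 1; -1, 0] ∈ Kset p :=
    mem_Kset_of (by simp) (by simp) (by simp) (by simp) (by simp)
  obtain ⟨k, hk, l, hl, hkl⟩ :
      ∃ k ∈ Kset p, ∃ l ∈ Kset p, weylRep q i = k * !![q⁻¹, 0; 0, q] * l := by
    fin_cases i
    · exact ⟨1, h1, 1, h1, by simp [weylRep]⟩
    · exact ⟨1, h1, _, hs, by simp [weylRep]⟩
    · exact ⟨_, hs, _, hs', by simp [weylRep]⟩
    · exact ⟨_, hs, 1, h1, by simp [weylRep]⟩
  exact ⟨u * k, Kset_mul hu.1 hk, l * v, Kset_mul hl hv.1, by simp only [hkl, mul_assoc]⟩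

theorem Kset_exists_unit_col {g : Matrix (Fin 2) (Fin 2) ℚ_[p]} (hg : g ∈ Kset p) :
    ∃ i, ‖g i 0‖ = 1 := by
  by_contra! h
  have hlt (i : Fin 2) : ‖g i 0‖ < 1 := (hg.2 i 0).lt_of_ne (h i)
  have hdet := hg.1
  rw [det_fin_two, sub_eq_add_neg, ← neg_mul] at hdet
  have := Padic.norm_add_lt_one (Padic.norm_mul_lt_one_of_lt_of_le (hlt 0) (hg.2 1 1))
    (Padic.norm_mul_lt_one_of_le_of_lt (x := -g 0 1) (by rw [norm_neg]; exact hg.2 0 1) (hlt 1))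
  rw [hdet, norm_one] at this
  exact this.false

theorem Kset_transpose {g : Matrix (Fin 2) (Fin 2) ℚ_[p]} (hg : g ∈ Kset p) : gᵀ ∈ Kset p :=
  ⟨by rw [det_transpose, hg.1], fun i k => hg.2 k i⟩

theorem DCp_Kset_eq_iUnion {q : ℚ_[p]} (hq0 : q ≠ 0) (hq : ‖q‖ < 1) :
    DCp p (Kset p) !![q⁻¹, 0; 0, q] (Kset p) =
      ⋃ i : Fin 4, DCp p (Uset p) (weylRep q i) (Uset p) := by
  refine subset_antisymm ?_ (Set.iUnion_subset (DCp_Uset_subset_DCp_Kset q))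
  rintro m ⟨g, hg, h, hh, rfl⟩
  have hentry (r s : Fin 2) : (q • (g * !![q⁻¹, 0; 0, q] * h)) r s
      = g r 0 * h 0 s + q * q * (g r 1 * h 1 s) := by
    simp [mul_apply, Fin.sum_univ_two]; field_simp
  have hsmall (r s : Fin 2) : ‖q * q * (g r 1 * h 1 s)‖ < 1 :=
    Padic.norm_mul_lt_one_of_lt_of_le (Padic.norm_mul_lt_one_of_lt_of_le hq hq.le)
      (Padic.norm_mul_le_one (hg.2 _ _) (hh.2 _ _))
  have hint (r s : Fin 2) : ‖(q • (g * !![q⁻¹, 0; 0, q] * h)) r s‖ ≤ 1 := by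
    rw [hentry]
    exact Padic.norm_add_le_one (Padic.norm_mul_le_one (hg.2 _ _) (hh.2 _ _)) (hsmall r s).le
  obtain ⟨r, hr⟩ := Kset_exists_unit_col hg
  obtain ⟨s, hs⟩ := Kset_exists_unit_col (Kset_transpose hh)
  obtain ⟨i, hi⟩ := exists_hasPivot hint ⟨r, s, by
    rw [hentry]
    refine Padic.norm_add_eq_one ?_ (hsmall r s)
    rw [norm_mul, hr, one_mul]
    exact hs⟩
  refine Set.mem_iUnion.2 ⟨i, mem_DCp_Uset_of_hasPivot hq0 ?_ hint hi⟩
  rw [det_mul, det_mul, hg.1, hh.1, det_fin_two_of]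
  field_simp
  ring

end Helpers

/-- For `j ≥ 1`, the double coset `K·diag(p^(−j), p^(j))·K` in `SL(2, ℚ_p)`
is the union of exactly four pairwise disjoint double cosets of the Iwahori subgroup `U`,
with the four explicit representatives `wmat p j i`. -/
theorem stmt6 (p : ℕ) [Fact p.Prime] (j : ℕ) (hj : 1 ≤ j) :
    DCp p (Kset p) (!![(p : ℚ_[p]) ^ (-(j : ℤ)), 0; 0, (p : ℚ_[p]) ^ (j : ℤ)]) (Kset p) =
        (⋃ i : Fin 4, DCp p (Uset p) (wmat p j i) (Uset p)) ∧
      ∀ i i' : Fin 4, i ≠ i' →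
        Disjoint (DCp p (Uset p) (wmat p j i) (Uset p))
          (DCp p (Uset p) (wmat p j i') (Uset p)) := by
  have hq0 : (p : ℚ_[p]) ^ j ≠ 0 :=
    pow_ne_zero _ (by exact_mod_cast (Fact.out : p.Prime).ne_zero)
  have hq : ‖(p : ℚ_[p]) ^ j‖ < 1 := by
    rw [norm_pow]
    exact pow_lt_one₀ (norm_nonneg _) Padic.norm_p_lt_one (by omega)
  rw [wmat_eq_weylRep, _root_.zpow_neg, zpow_natCast]
  refine ⟨DCp_Kset_eq_iUnion hq0 hq, fun i i' hne => Set.disjoint_left.2 fun m hm hm' => hne ?_⟩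
  exact (hasPivot_of_mem_DCp_Uset hq0 hq hm).unique (hasPivot_of_mem_DCp_Uset hq0 hq hm')
end

section
/- Let p be a prime, j ∈ ℤ, and α ∈ SL(2, ℚ_p). (a) If α lies in the double coset U·diag(p^(j), p^(−j))·U, then the index of the subgroup U ∩ α⁻¹·U·α in U equals p^(|2j|). (b) If α lies in the double coset U·(0, −p^(−j); p^(j), 0)·U, then the index of U ∩ α⁻¹·U·α in U equals p^(|2j+1|). -/
open Matrix

/-- The left coset `r·H'` of the subgroup `H' = U ∩ α⁻¹·U·α` inside `SL(2, ℚ_p)`. -/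
noncomputable def cosetOf (p : ℕ) [Fact p.Prime] (α r : Matrix (Fin 2) (Fin 2) ℚ_[p]) :
    Set (Matrix (Fin 2) (Fin 2) ℚ_[p]) :=
  {m | ∃ h, (h ∈ Uset p ∧ α * h * α⁻¹ ∈ Uset p) ∧ m = r * h}

/-- "The index of `U ∩ α⁻¹·U·α` in `U` equals `n`":  `U` is the disjoint union of exactly
`n` left cosets of `U ∩ α⁻¹·U·α`. -/
noncomputable def RelIndexIs (p : ℕ) [Fact p.Prime] (α : Matrix (Fin 2) (Fin 2) ℚ_[p])
    (n : ℕ) : Prop :=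
  ∃ R : Finset (Matrix (Fin 2) (Fin 2) ℚ_[p]),
    R.card = n ∧ (↑R : Set (Matrix (Fin 2) (Fin 2) ℚ_[p])) ⊆ Uset p ∧
    (∀ r₁ ∈ R, ∀ r₂ ∈ R, r₁ ≠ r₂ → Disjoint (cosetOf p α r₁) (cosetOf p α r₂)) ∧
    (⋃ r ∈ R, cosetOf p α r) = Uset p

section Iwahori

variable {p : ℕ} [Fact p.Prime]

theorem mem_Uset_iff {g : Matrix (Fin 2) (Fin 2) ℚ_[p]} :
    g ∈ Uset p ↔ g.det = 1 ∧ ‖g 0 0‖ ≤ 1 ∧ ‖g 0 1‖ ≤ (p : ℝ)⁻¹ ∧ ‖g 1 0‖ ≤ 1 ∧ ‖g 1 1‖ ≤ 1 := by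
  have hp : (p : ℝ)⁻¹ ≤ 1 :=
    inv_le_one_of_one_le₀ (by exact_mod_cast (Fact.out : p.Prime).one_lt.le)
  simp only [Uset, Kset, Set.mem_ofPred_eq, Fin.forall_fin_two]
  constructor
  · rintro ⟨⟨h, ⟨h1, -⟩, h3, h4⟩, h5⟩
    exact ⟨h, h1, h5, h3, h4⟩
  · rintro ⟨h, h1, h2, h3, h4⟩
    exact ⟨⟨h, ⟨h1, h2.trans hp⟩, h3, h4⟩, h2⟩

theorem Matrix.inv_fin_two_of_det_eq_one {R : Type*} [CommRing R] {g : Matrix (Fin 2) (Fin 2) R}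
    (hg : g.det = 1) : g⁻¹ = !![g 1 1, -g 0 1; -g 1 0, g 0 0] := by
  rw [Matrix.inv_def, hg, Ring.inverse_one, one_smul, Matrix.adjugate_fin_two]

theorem inv_mem_Uset {g : Matrix (Fin 2) (Fin 2) ℚ_[p]} (hg : g ∈ Uset p) : g⁻¹ ∈ Uset p := by
  rw [mem_Uset_iff] at hg
  obtain ⟨h, h1, h2, h3, h4⟩ := hg
  rw [Matrix.inv_fin_two_of_det_eq_one h, mem_Uset_iff]
  rw [Matrix.det_fin_two] at h
  refine ⟨?_, ?_⟩
  · rw [Matrix.det_fin_two_of]; linear_combination h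
  · simp [*]

theorem isUnit_det_of_mem_Uset {g : Matrix (Fin 2) (Fin 2) ℚ_[p]} (hg : g ∈ Uset p) :
    IsUnit g.det := by
  rw [hg.1.1]; exact isUnit_one

theorem mul_mem_Uset {g h : Matrix (Fin 2) (Fin 2) ℚ_[p]} (hg : g ∈ Uset p) (hh : h ∈ Uset p) :
    g * h ∈ Uset p := by
  have hadd : ∀ {x y : ℚ_[p]} {r : ℝ}, ‖x‖ ≤ r → ‖y‖ ≤ r → ‖x + y‖ ≤ r := fun hx hy =>
    (Padic.nonarchimedean _ _).trans (max_le hx hy)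
  refine ⟨⟨by rw [Matrix.det_mul, hg.1.1, hh.1.1, one_mul], fun i j => ?_⟩, ?_⟩ <;>
    rw [Matrix.mul_apply, Fin.sum_univ_two] <;> apply hadd <;> rw [norm_mul]
  · exact mul_le_one₀ (hg.1.2 _ _) (norm_nonneg _) (hh.1.2 _ _)
  · exact mul_le_one₀ (hg.1.2 _ _) (norm_nonneg _) (hh.1.2 _ _)
  · exact (mul_le_of_le_one_left (norm_nonneg _) (hg.1.2 _ _)).trans hh.2
  · exact (mul_le_of_le_one_right (norm_nonneg _) (hh.1.2 _ _)).trans hg.2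

theorem one_mem_Uset : (1 : Matrix (Fin 2) (Fin 2) ℚ_[p]) ∈ Uset p := by
  simp [mem_Uset_iff]

theorem mul_mul_inv_mem_Uset_iff {u x : Matrix (Fin 2) (Fin 2) ℚ_[p]} (hu : u ∈ Uset p) :
    u * x * u⁻¹ ∈ Uset p ↔ x ∈ Uset p := by
  have hd := isUnit_det_of_mem_Uset hu
  refine ⟨fun h => ?_, fun h => mul_mem_Uset (mul_mem_Uset hu h) (inv_mem_Uset hu)⟩
  have key := mul_mem_Uset (mul_mem_Uset (inv_mem_Uset hu) h) hu
  rwa [Matrix.mul_assoc, Matrix.mul_assoc, Matrix.nonsing_inv_mul _ hd, Matrix.mul_one,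
    Matrix.nonsing_inv_mul_cancel_left _ _ hd] at key

theorem norm_diag_eq_one_of_mem_Uset {g : Matrix (Fin 2) (Fin 2) ℚ_[p]} (hg : g ∈ Uset p) :
    ‖g 0 0‖ = 1 ∧ ‖g 1 1‖ = 1 := by
  obtain ⟨h, h1, h2, h3, h4⟩ := mem_Uset_iff.1 hg
  have hp : (p : ℝ)⁻¹ < 1 :=
    inv_lt_one_of_one_lt₀ (by exact_mod_cast (Fact.out : p.Prime).one_lt)
  have hbc : ‖g 0 1 * g 1 0‖ < 1 := by
    rw [norm_mul]
    exact ((mul_le_of_le_one_right (norm_nonneg _) h3).trans h2).trans_lt hp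
  have had : ‖g 0 0‖ * ‖g 1 1‖ = 1 := by
    rw [Matrix.det_fin_two] at h
    rw [← norm_mul, show g 0 0 * g 1 1 = 1 + g 0 1 * g 1 0 by linear_combination h,
      Padic.add_eq_max_of_ne (by rw [norm_one]; exact hbc.ne'), norm_one,
      max_eq_left hbc.le]
  constructor <;> nlinarith [norm_nonneg (g 0 0), norm_nonneg (g 1 1)]

theorem cosetOf_subset_Uset {α r : Matrix (Fin 2) (Fin 2) ℚ_[p]} (hr : r ∈ Uset p) :
    cosetOf p α r ⊆ Uset p := by
  rintro _ ⟨h, ⟨hh, -⟩, rfl⟩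
  exact mul_mem_Uset hr hh

theorem mem_cosetOf_iff {α r g : Matrix (Fin 2) (Fin 2) ℚ_[p]} (hr : r ∈ Uset p)
    (hg : g ∈ Uset p) : g ∈ cosetOf p α r ↔ α * (r⁻¹ * g) * α⁻¹ ∈ Uset p := by
  have hd := isUnit_det_of_mem_Uset hr
  constructor
  · rintro ⟨h, ⟨-, hh⟩, rfl⟩
    rwa [Matrix.nonsing_inv_mul_cancel_left _ _ hd]
  · intro h
    exact ⟨r⁻¹ * g, ⟨mul_mem_Uset (inv_mem_Uset hr) hg, h⟩,
      (Matrix.mul_nonsing_inv_cancel_left _ _ hd).symm⟩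

theorem self_mem_cosetOf {α : Matrix (Fin 2) (Fin 2) ℚ_[p]} (hα : IsUnit α.det)
    (r : Matrix (Fin 2) (Fin 2) ℚ_[p]) : r ∈ cosetOf p α r := by
  refine ⟨1, ⟨one_mem_Uset, ?_⟩, (Matrix.mul_one r).symm⟩
  rw [Matrix.mul_one, Matrix.mul_nonsing_inv _ hα]
  exact one_mem_Uset

/-- A family of representatives of the left cosets computes the index. -/
theorem relIndexIs_of_existsUnique {ι : Type*} [Fintype ι]
    {α : Matrix (Fin 2) (Fin 2) ℚ_[p]} (hα : IsUnit α.det)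
    (s : ι → Matrix (Fin 2) (Fin 2) ℚ_[p]) (hs : ∀ t, s t ∈ Uset p)
    (h : ∀ g ∈ Uset p, ∃! t, g ∈ cosetOf p α (s t)) :
    RelIndexIs p α (Fintype.card ι) := by
  classical
  have hinj : Function.Injective s := fun t t' e =>
    (h (s t) (hs t)).unique (self_mem_cosetOf hα _) (e ▸ self_mem_cosetOf hα _)
  refine ⟨Finset.univ.image s, ?_, ?_, ?_, ?_⟩
  · rw [Finset.card_image_of_injective _ hinj, Finset.card_univ]
  · intro x hx
    simp only [Finset.coe_image, Finset.coe_univ, Set.image_univ, Set.mem_range] at hx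
    obtain ⟨t, rfl⟩ := hx
    exact hs t
  · simp only [Finset.mem_image, Finset.mem_univ, true_and, forall_exists_index,
      forall_apply_eq_imp_iff]
    intro t t' hne
    rw [Set.disjoint_left]
    intro g hg hg'
    exact hne (congrArg s ((h g (cosetOf_subset_Uset (hs t) hg)).unique hg hg'))
  · ext g
    simp only [Finset.mem_image, Finset.mem_univ, true_and, Set.iUnion_exists,
      Set.iUnion_iUnion_eq', Set.mem_iUnion]
    exact ⟨fun ⟨t, ht⟩ => cosetOf_subset_Uset (hs t) ht, fun hg => (h g hg).exists⟩

/-- The residues `0, …, p ^ n - 1` represent `ℤ_p` modulo `p ^ n`. -/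
theorem Padic.existsUnique_norm_sub_val_le {x : ℚ_[p]} (hx : ‖x‖ ≤ 1) (n : ℕ) :
    ∃! t : ZMod (p ^ n), ‖x - (t.val : ℚ_[p])‖ ≤ (p : ℝ) ^ (-(n : ℤ)) := by
  obtain ⟨x, rfl⟩ : ∃ y : ℤ_[p], (y : ℚ_[p]) = x := ⟨⟨x, hx⟩, rfl⟩
  have key : ∀ t : ZMod (p ^ n), ‖(x : ℚ_[p]) - (t.val : ℚ_[p])‖ ≤ (p : ℝ) ^ (-(n : ℤ)) ↔
      t = PadicInt.toZModPow n x := by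
    intro t
    have e : ‖(x : ℚ_[p]) - (t.val : ℚ_[p])‖ = ‖x - (t.val : ℤ_[p])‖ := by
      rw [PadicInt.norm_def]; push_cast; rfl
    rw [e, PadicInt.norm_le_pow_iff_mem_span_pow, ← PadicInt.ker_toZModPow, RingHom.mem_ker,
      map_sub, map_natCast, ZMod.natCast_zmod_val, sub_eq_zero, eq_comm]
  exact ⟨_, (key _).2 rfl, fun t ht => (key t).1 ht⟩

theorem relIndexIs_of_conj_mem_iff {w : Matrix (Fin 2) (Fin 2) ℚ_[p]} (hw : IsUnit w.det) (m : ℤ)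
    (h : ∀ g ∈ Uset p, w * g * w⁻¹ ∈ Uset p ↔
      ‖g 1 0‖ ≤ (p : ℝ) ^ (-m) ∧ ‖g 0 1‖ ≤ (p : ℝ) ^ (m - 1)) :
    RelIndexIs p w (p ^ m.natAbs) := by
  have hp1 : (1 : ℝ) < p := by exact_mod_cast (Fact.out : p.Prime).one_lt
  have hp0 : (p : ℝ) ≠ 0 := by positivity
  have hpQ : (p : ℚ_[p]) ≠ 0 := by exact_mod_cast (Fact.out : p.Prime).ne_zero
  have hcard : Fintype.card (ZMod (p ^ m.natAbs)) = p ^ m.natAbs := ZMod.card _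
  rw [← hcard]
  have hnat : ∀ k : ℕ, ‖(k : ℚ_[p])‖ ≤ 1 := fun k => by
    exact_mod_cast Padic.norm_int_le_one (p := p) k
  obtain ⟨n, rfl | rfl⟩ := m.eq_nat_or_neg
  · rw [Int.natAbs_natCast]
    have hs : ∀ t : ZMod (p ^ n), !![1, 0; (t.val : ℚ_[p]), 1] ∈ Uset p := fun t => by
      simp [mem_Uset_iff, Matrix.det_fin_two_of, hnat, -ZMod.natCast_val]
    refine relIndexIs_of_existsUnique hw (fun t => !![1, 0; (t.val : ℚ_[p]), 1]) hs fun g hg => ?_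
    have ha := (norm_diag_eq_one_of_mem_Uset hg).1
    have ha0 : g 0 0 ≠ 0 := norm_ne_zero_iff.1 (by rw [ha]; exact one_ne_zero)
    have hx : ‖g 1 0 / g 0 0‖ ≤ 1 := by rw [norm_div, ha, div_one]; exact hg.1.2 1 0
    have hb : ‖g 0 1‖ ≤ (p : ℝ) ^ ((n : ℤ) - 1) := hg.2.trans (by
      rw [← _root_.zpow_neg_one]; exact zpow_le_zpow_right₀ hp1.le (by omega))
    convert Padic.existsUnique_norm_sub_val_le hx n using 2 with t
    rw [mem_cosetOf_iff (hs t) hg, h _ (mul_mem_Uset (inv_mem_Uset (hs t)) hg),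
      Matrix.inv_fin_two_of_det_eq_one (hs t).1.1]
    have e : g 1 0 / g 0 0 - t.val = (-(t.val : ℚ_[p]) * g 0 0 + g 1 0) / g 0 0 := by
      field_simp; ring
    rw [e, norm_div, ha, div_one]
    simp [Matrix.mul_apply, Fin.sum_univ_two, hb]
  · rw [Int.natAbs_neg, Int.natAbs_natCast]
    have hs : ∀ t : ZMod (p ^ n), !![1, (p : ℚ_[p]) * t.val; 0, 1] ∈ Uset p := fun t => by
      have hpt : (p : ℝ)⁻¹ * ‖(t.val : ℚ_[p])‖ ≤ (p : ℝ)⁻¹ :=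
        mul_le_of_le_one_right (by positivity) (hnat _)
      simpa [mem_Uset_iff, Matrix.det_fin_two_of] using hpt
    refine relIndexIs_of_existsUnique hw (fun t => !![1, (p : ℚ_[p]) * t.val; 0, 1]) hs
      fun g hg => ?_
    have hd := (norm_diag_eq_one_of_mem_Uset hg).2
    have hd0 : g 1 1 ≠ 0 := norm_ne_zero_iff.1 (by rw [hd]; exact one_ne_zero)
    have hx : ‖g 0 1 / (p * g 1 1)‖ ≤ 1 := by
      rw [norm_div, norm_mul, hd, mul_one, Padic.norm_p]
      exact div_le_one_of_le₀ hg.2 (by positivity)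
    have hc : ‖g 1 0‖ ≤ (p : ℝ) ^ (n : ℤ) := (hg.1.2 1 0).trans (by
      rw [zpow_natCast]; exact one_le_pow₀ hp1.le)
    convert Padic.existsUnique_norm_sub_val_le hx n using 2 with t
    rw [mem_cosetOf_iff (hs t) hg, h _ (mul_mem_Uset (inv_mem_Uset (hs t)) hg),
      Matrix.inv_fin_two_of_det_eq_one (hs t).1.1]
    have e : g 0 1 / (p * g 1 1) - t.val =
        (g 0 1 + -((p : ℚ_[p]) * t.val * g 1 1)) / (p * g 1 1) := by
      field_simp; ring
    rw [e, norm_div, norm_mul, hd, mul_one, Padic.norm_p, div_le_iff₀ (by positivity),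
      ← _root_.zpow_neg_one, ← zpow_add₀ hp0]
    simp only [zpow_natCast] at hc
    simp [Matrix.mul_apply, Fin.sum_univ_two, hc, sub_eq_add_neg]

/-- The index depends only on the double coset of `w` modulo `U`. -/
theorem RelIndexIs.mul_mul {w a b : Matrix (Fin 2) (Fin 2) ℚ_[p]} {n : ℕ}
    (hw : RelIndexIs p w n) (ha : a ∈ Uset p) (hb : b ∈ Uset p) :
    RelIndexIs p (a * w * b) n := by
  classical
  obtain ⟨R, hcard, hR, hdisj, hU⟩ := hw
  have hbd := isUnit_det_of_mem_Uset hb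
  have hb' : (b⁻¹)⁻¹ = b := Matrix.nonsing_inv_nonsing_inv _ hbd
  have hconj : ∀ x, b * (b⁻¹ * x * b) * b⁻¹ = x := fun x => by
    rw [← Matrix.mul_assoc, Matrix.mul_nonsing_inv_cancel_right _ _ hbd,
      Matrix.mul_nonsing_inv_cancel_left _ _ hbd]
  have hinj : Function.Injective fun x => b⁻¹ * x * b := fun x y e => by
    rw [← hconj x, ← hconj y]; exact congrArg (fun z => b * z * b⁻¹) e
  have hmem : ∀ {r g}, r ∈ Uset p → g ∈ Uset p →
      (g ∈ cosetOf p (a * w * b) (b⁻¹ * r * b) ↔ b * g * b⁻¹ ∈ cosetOf p w r) := by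
    intro r g hr hg
    rw [mem_cosetOf_iff (mul_mem_Uset (mul_mem_Uset (inv_mem_Uset hb) hr) hb) hg,
      mem_cosetOf_iff hr ((mul_mul_inv_mem_Uset_iff hb).2 hg), ← mul_mul_inv_mem_Uset_iff (x := w * _ * w⁻¹) ha]
    simp only [Matrix.mul_inv_rev, hb', Matrix.mul_assoc,
      Matrix.mul_nonsing_inv_cancel_left _ _ hbd]
  have hRU : ∀ {r}, r ∈ R → b⁻¹ * r * b ∈ Uset p := fun hr =>
    mul_mem_Uset (mul_mem_Uset (inv_mem_Uset hb) (hR hr)) hb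
  refine ⟨R.image fun x => b⁻¹ * x * b, ?_, ?_, ?_, ?_⟩
  · rw [Finset.card_image_of_injective _ hinj, hcard]
  · intro x hx
    obtain ⟨r, hr, rfl⟩ := Finset.mem_image.1 (Finset.mem_coe.1 hx)
    exact hRU hr
  · simp only [Finset.mem_image, forall_exists_index, and_imp, forall_apply_eq_imp_iff₂]
    intro r hr r' hr' hne
    rw [Set.disjoint_left]
    intro g hg hg'
    have hgU := cosetOf_subset_Uset (hRU hr) hg
    exact Set.disjoint_left.1 (hdisj r hr r' hr' fun e => hne (by rw [e]))
      ((hmem (hR hr) hgU).1 hg) ((hmem (hR hr') hgU).1 hg')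
  · ext g
    simp only [Set.mem_iUnion, Finset.mem_image, exists_prop, exists_exists_and_eq_and]
    constructor
    · rintro ⟨r, hr, hg⟩
      exact cosetOf_subset_Uset (hRU hr) hg
    · intro hg
      have hg' := (mul_mul_inv_mem_Uset_iff hb).2 hg
      rw [← hU] at hg'
      simp only [Set.mem_iUnion, exists_prop] at hg'
      obtain ⟨r, hr, hgr⟩ := hg'
      exact ⟨r, hr, (hmem (hR hr) hg).2 hgr⟩

theorem norm_zpow_mul_le_iff (k l : ℤ) (x : ℚ_[p]) :
    ‖(p : ℚ_[p]) ^ k * x‖ ≤ (p : ℝ) ^ l ↔ ‖x‖ ≤ (p : ℝ) ^ (l + k) := by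
  have hp : (0 : ℝ) < p := by exact_mod_cast (Fact.out : p.Prime).pos
  rw [norm_mul, Padic.norm_p_zpow, _root_.zpow_neg, zpow_add₀ hp.ne', inv_mul_le_iff₀ (zpow_pos hp k),
    mul_comm]

theorem relIndexIs_diag (j : ℤ) :
    RelIndexIs p !![(p : ℚ_[p]) ^ j, 0; 0, (p : ℚ_[p]) ^ (-j)] (p ^ (2 * j).natAbs) := by
  have hp : (p : ℚ_[p]) ≠ 0 := by exact_mod_cast (Fact.out : p.Prime).ne_zero
  have hj : (p : ℚ_[p]) ^ j * (p : ℚ_[p]) ^ (-j) = 1 := by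
    rw [← zpow_add₀ hp, add_neg_cancel, zpow_zero]
  have hdet : (!![(p : ℚ_[p]) ^ j, 0; 0, (p : ℚ_[p]) ^ (-j)]).det = 1 := by
    rw [Matrix.det_fin_two_of, hj, zero_mul, sub_zero]
  refine relIndexIs_of_conj_mem_iff (hdet ▸ isUnit_one) _ fun g hg => ?_
  have e : !![(p : ℚ_[p]) ^ j, 0; 0, (p : ℚ_[p]) ^ (-j)] * g *
      !![(p : ℚ_[p]) ^ j, 0; 0, (p : ℚ_[p]) ^ (-j)]⁻¹ =
      !![g 0 0, (p : ℚ_[p]) ^ (2 * j) * g 0 1; (p : ℚ_[p]) ^ (-(2 * j)) * g 1 0, g 1 1] := by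
    rw [Matrix.inv_fin_two_of_det_eq_one hdet, show 2 * j = j + j by ring, neg_add,
      zpow_add₀ hp, zpow_add₀ hp]
    conv_lhs => rw [Matrix.eta_fin_two g, Matrix.mul_fin_two, Matrix.mul_fin_two]
    ext i k
    fin_cases i <;> fin_cases k <;> simp <;> field_simp
  have hdet' : (!![(p : ℚ_[p]) ^ j, 0; 0, (p : ℚ_[p]) ^ (-j)] * g *
      !![(p : ℚ_[p]) ^ j, 0; 0, (p : ℚ_[p]) ^ (-j)]⁻¹).det = 1 := by
    rw [Matrix.det_conj ((Matrix.isUnit_iff_isUnit_det _).2 (hdet ▸ isUnit_one)), hg.1.1]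
  have h1 := norm_zpow_mul_le_iff (2 * j) (-1) (g 0 1)
  have h2 := norm_zpow_mul_le_iff (-(2 * j)) 0 (g 1 0)
  rw [_root_.zpow_neg_one, neg_add_eq_sub] at h1
  rw [zpow_zero, zero_add] at h2
  rw [mem_Uset_iff, hdet', e, ← h1, ← h2]
  simp [(norm_diag_eq_one_of_mem_Uset hg).1, (norm_diag_eq_one_of_mem_Uset hg).2, and_comm]

theorem relIndexIs_antidiag (j : ℤ) :
    RelIndexIs p !![0, -(p : ℚ_[p]) ^ (-j); (p : ℚ_[p]) ^ j, 0] (p ^ (2 * j + 1).natAbs) := by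
  have hp : (p : ℚ_[p]) ≠ 0 := by exact_mod_cast (Fact.out : p.Prime).ne_zero
  have hj : (p : ℚ_[p]) ^ (-j) * (p : ℚ_[p]) ^ j = 1 := by
    rw [← zpow_add₀ hp, neg_add_cancel, zpow_zero]
  have hdet : (!![0, -(p : ℚ_[p]) ^ (-j); (p : ℚ_[p]) ^ j, 0]).det = 1 := by
    rw [Matrix.det_fin_two_of, neg_mul, hj]; ring
  refine relIndexIs_of_conj_mem_iff (hdet ▸ isUnit_one) _ fun g hg => ?_
  have e : !![0, -(p : ℚ_[p]) ^ (-j); (p : ℚ_[p]) ^ j, 0] * g *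
      !![0, -(p : ℚ_[p]) ^ (-j); (p : ℚ_[p]) ^ j, 0]⁻¹ =
      !![g 1 1, -((p : ℚ_[p]) ^ (-(2 * j)) * g 1 0); -((p : ℚ_[p]) ^ (2 * j) * g 0 1), g 0 0] := by
    rw [Matrix.inv_fin_two_of_det_eq_one hdet, show 2 * j = j + j by ring, neg_add,
      zpow_add₀ hp, zpow_add₀ hp]
    conv_lhs => rw [Matrix.eta_fin_two g, Matrix.mul_fin_two, Matrix.mul_fin_two]
    ext i k
    fin_cases i <;> fin_cases k <;> simp <;> field_simp
  have hdet' : (!![0, -(p : ℚ_[p]) ^ (-j); (p : ℚ_[p]) ^ j, 0] * g *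
      !![0, -(p : ℚ_[p]) ^ (-j); (p : ℚ_[p]) ^ j, 0]⁻¹).det = 1 := by
    rw [Matrix.det_conj ((Matrix.isUnit_iff_isUnit_det _).2 (hdet ▸ isUnit_one)), hg.1.1]
  have h1 := norm_zpow_mul_le_iff (2 * j) 0 (g 0 1)
  have h2 := norm_zpow_mul_le_iff (-(2 * j)) (-1) (g 1 0)
  rw [zpow_zero, zero_add] at h1
  rw [_root_.zpow_neg_one, ← neg_add, add_comm 1] at h2
  rw [mem_Uset_iff, hdet', e, add_sub_cancel_right, ← h1, ← h2]
  simp [(norm_diag_eq_one_of_mem_Uset hg).1, (norm_diag_eq_one_of_mem_Uset hg).2]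

end Iwahori

/-- For `α ∈ SL(2, ℚ_p)`:
(a) if `α ∈ U·diag(p^j, p^(−j))·U` then `[U : U ∩ α⁻¹Uα] = p^|2j|`;
(b) if `α ∈ U·(0, −p^(−j); p^j, 0)·U` then `[U : U ∩ α⁻¹Uα] = p^|2j+1|`. -/
theorem stmt7 (p : ℕ) [Fact p.Prime] (j : ℤ) (α : Matrix (Fin 2) (Fin 2) ℚ_[p])
    (hα : α.det = 1) :
    (α ∈ DCp p (Uset p) (!![(p : ℚ_[p]) ^ j, 0; 0, (p : ℚ_[p]) ^ (-j)]) (Uset p) →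
      RelIndexIs p α (p ^ (2 * j).natAbs)) ∧
    (α ∈ DCp p (Uset p) (!![0, -(p : ℚ_[p]) ^ (-j); (p : ℚ_[p]) ^ j, 0]) (Uset p) →
      RelIndexIs p α (p ^ (2 * j + 1).natAbs)) := by
  constructor
  · rintro ⟨a, ha, b, hb, rfl⟩
    exact (relIndexIs_diag j).mul_mul ha hb
  · rintro ⟨a, ha, b, hb, rfl⟩
    exact (relIndexIs_antidiag j).mul_mul ha hb
end

section
/- Let p be a prime and let x, y ∈ ℚ_p have p-adic valuation 0. Then: (i) the SL(2, ℤ_p)-double cosets K·(1, x/p; 0, 1)·K and K·(p, y/p; 0, 1/p)·K are equal; in particular they are independent of the choice of the units x and y. (ii) For every γ ∈ K such that every entry of the matrix γ − (1, 0; −p/x, 1) has p-adic valuation ≥ 2, one has (1, x/p; 0, 1)·γ ∈ K·(p, y/p; 0, 1/p). -/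
open Matrix

theorem mem_Kset_iff {p : ℕ} [Fact p.Prime] {g : Matrix (Fin 2) (Fin 2) ℚ_[p]} :
    g ∈ Kset p ↔ g.det = 1 ∧ ∀ i j, g i j ∈ PadicInt.subring p :=
  Iff.rfl

theorem mul_mem_Kset {p : ℕ} [Fact p.Prime] {g h : Matrix (Fin 2) (Fin 2) ℚ_[p]}
    (hg : g ∈ Kset p) (hh : h ∈ Kset p) : g * h ∈ Kset p := by
  rw [mem_Kset_iff] at *
  refine ⟨by rw [det_mul, hg.1, hh.1, one_mul], fun i j => ?_⟩
  rw [mul_apply]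
  exact sum_mem fun k _ => mul_mem (hg.2 i k) (hh.2 k j)

theorem adjugate_mem_Kset {p : ℕ} [Fact p.Prime] {g : Matrix (Fin 2) (Fin 2) ℚ_[p]}
    (hg : g ∈ Kset p) : g.adjugate ∈ Kset p := by
  rw [mem_Kset_iff] at *
  refine ⟨by simp [det_adjugate, hg.1], fun i j => ?_⟩
  rw [adjugate_fin_two]
  fin_cases i <;> fin_cases j <;> simp [-PadicInt.mem_subring_iff, hg.2]

theorem adjugate_mul_of_mem_Kset {p : ℕ} [Fact p.Prime] {g : Matrix (Fin 2) (Fin 2) ℚ_[p]}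
    (hg : g ∈ Kset p) : g.adjugate * g = 1 := by
  rw [adjugate_mul, hg.1, one_smul]

theorem mul_adjugate_of_mem_Kset {p : ℕ} [Fact p.Prime] {g : Matrix (Fin 2) (Fin 2) ℚ_[p]}
    (hg : g ∈ Kset p) : g * g.adjugate = 1 := by
  rw [mul_adjugate, hg.1, one_smul]

theorem DCp_Kset_subset {p : ℕ} [Fact p.Prime] {g h k l : Matrix (Fin 2) (Fin 2) ℚ_[p]}
    (hk : k ∈ Kset p) (hl : l ∈ Kset p) (hg : g = k * h * l) :
    DCp p (Kset p) g (Kset p) ⊆ DCp p (Kset p) h (Kset p) := by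
  rintro _ ⟨a, ha, b, hb, rfl⟩
  exact ⟨a * k, mul_mem_Kset ha hk, l * b, mul_mem_Kset hl hb, by
    simp only [hg, Matrix.mul_assoc]⟩

theorem DCp_Kset_eq {p : ℕ} [Fact p.Prime] {g h k l : Matrix (Fin 2) (Fin 2) ℚ_[p]}
    (hk : k ∈ Kset p) (hl : l ∈ Kset p) (hg : g * l = k * h) :
    DCp p (Kset p) g (Kset p) = DCp p (Kset p) h (Kset p) := by
  refine (DCp_Kset_subset hk (adjugate_mem_Kset hl) ?_).antisymm
    (DCp_Kset_subset (adjugate_mem_Kset hk) hl ?_)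
  · rw [← hg, Matrix.mul_assoc, mul_adjugate_of_mem_Kset hl, Matrix.mul_one]
  · rw [Matrix.mul_assoc, hg, ← Matrix.mul_assoc, adjugate_mul_of_mem_Kset hk, Matrix.one_mul]

theorem lowerUnipotent_mem_Kset {p : ℕ} [Fact p.Prime] {c : ℚ_[p]} (hc : ‖c‖ ≤ 1) :
    !![1, 0; c, 1] ∈ Kset p := by
  refine ⟨by simp [det_fin_two_of], fun i j => ?_⟩
  fin_cases i <;> fin_cases j <;> simp [hc]

/-- The `p`-adic numbers of norm at most `p⁻²` are the multiples of `p ^ 2` in `ℤ_p`. -/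
theorem exists_eq_sq_mul_of_norm_le {p : ℕ} [Fact p.Prime] {z : ℚ_[p]}
    (hz : ‖z‖ ≤ ((p : ℝ) ^ 2)⁻¹) : ∃ w ∈ PadicInt.subring p, z = (p : ℚ_[p]) ^ 2 * w := by
  have hp : (p : ℝ) ≠ 0 := Nat.cast_ne_zero.2 (Fact.out : p.Prime).ne_zero
  have hq : (p : ℚ_[p]) ≠ 0 := Nat.cast_ne_zero.2 (Fact.out : p.Prime).ne_zero
  refine ⟨z / (p : ℚ_[p]) ^ 2, ?_, by field_simp⟩
  change ‖z / (p : ℚ_[p]) ^ 2‖ ≤ 1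
  rw [norm_div, norm_pow, Padic.norm_p, inv_pow]
  exact div_le_one_of_le₀ hz (by positivity)

theorem upperUnipotent_mul_mem_coset {p : ℕ} [Fact p.Prime] {x y : ℚ_[p]} (hx : ‖x‖ = 1)
    (hy : ‖y‖ = 1) {γ : Matrix (Fin 2) (Fin 2) ℚ_[p]} (hγ : γ ∈ Kset p)
    (h : ∀ i j, ‖(γ - !![1, 0; -(p : ℚ_[p]) / x, 1]) i j‖ ≤ ((p : ℝ) ^ 2)⁻¹) :
    ∃ k ∈ Kset p, !![1, x / (p : ℚ_[p]); 0, 1] * γ =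
      k * !![(p : ℚ_[p]), y / (p : ℚ_[p]); 0, (p : ℚ_[p])⁻¹] := by
  have hq : (p : ℚ_[p]) ≠ 0 := Nat.cast_ne_zero.2 (Fact.out : p.Prime).ne_zero
  have hx0 : x ≠ 0 := norm_ne_zero_iff.1 (by simp [hx])
  have hxm : x ∈ PadicInt.subring p := hx.le
  have hxi : x⁻¹ ∈ PadicInt.subring p := by
    change ‖x⁻¹‖ ≤ 1
    simp [hx]
  have hym : y ∈ PadicInt.subring p := hy.le
  have hqm : (p : ℚ_[p]) ∈ PadicInt.subring p := natCast_mem _ p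
  obtain ⟨α, hα, h₀⟩ := exists_eq_sq_mul_of_norm_le (h 0 0)
  obtain ⟨β, hβ, h₁⟩ := exists_eq_sq_mul_of_norm_le (h 1 0)
  have ha : γ 0 0 = 1 + (p : ℚ_[p]) ^ 2 * α := by rw [← h₀]; simp
  have hc : γ 1 0 = -(p : ℚ_[p]) / x + (p : ℚ_[p]) ^ 2 * β := by rw [← h₁]; simp
  set u := (p : ℚ_[p]) * α + x * β with hu
  set v := -x⁻¹ + (p : ℚ_[p]) * β with hv
  have hum : u ∈ PadicInt.subring p := add_mem (mul_mem hqm hα) (mul_mem hxm hβ)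
  have hvm : v ∈ PadicInt.subring p := add_mem (neg_mem hxi) (mul_mem hqm hβ)
  have hmul : !![1, x / (p : ℚ_[p]); 0, 1] * γ =
      !![u, -y * u + p * γ 0 1 + x * γ 1 1; v, -y * v + p * γ 1 1] *
        !![(p : ℚ_[p]), y / (p : ℚ_[p]); 0, (p : ℚ_[p])⁻¹] := by
    ext i j
    fin_cases i <;> fin_cases j <;>
      simp [mul_apply, Fin.sum_univ_two, ha, hc, hu, hv] <;> field_simp <;> ring
  refine ⟨_, mem_Kset_iff.2 ⟨?_, fun i j => ?_⟩, hmul⟩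
  · have hdet := congrArg det hmul
    rw [det_mul, det_mul, hγ.1, det_fin_two_of 1, det_fin_two_of (p : ℚ_[p]) (y / p),
      mul_inv_cancel₀ hq] at hdet
    simpa using hdet.symm
  · have hb := (mem_Kset_iff.1 hγ).2 0 1
    have hd := (mem_Kset_iff.1 hγ).2 1 1
    fin_cases i <;> fin_cases j
    · exact hum
    · exact add_mem (add_mem (mul_mem (neg_mem hym) hum) (mul_mem hqm hb)) (mul_mem hxm hd)
    · exact hvm
    · exact add_mem (mul_mem (neg_mem hym) hvm) (mul_mem hqm hd)

/-- For units `x, y ∈ ℚ_p`: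
(i) the double cosets `K·(1, x/p; 0, 1)·K` and `K·(p, y/p; 0, 1/p)·K` coincide;
(ii) if every entry of `γ − (1, 0; −p/x, 1)` has valuation ≥ 2 (with `γ ∈ K`), then
`(1, x/p; 0, 1)·γ` lies in the right coset `K·(p, y/p; 0, 1/p)`. -/
theorem stmt8 (p : ℕ) [Fact p.Prime] (x y : ℚ_[p]) (hx : ‖x‖ = 1) (hy : ‖y‖ = 1) :
    DCp p (Kset p) (!![1, x / (p : ℚ_[p]); 0, 1]) (Kset p) =
      DCp p (Kset p) (!![(p : ℚ_[p]), y / (p : ℚ_[p]); 0, ((p : ℚ_[p]))⁻¹]) (Kset p) ∧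
    ∀ γ : Matrix (Fin 2) (Fin 2) ℚ_[p], γ ∈ Kset p →
      (∀ i j, ‖(γ - !![1, 0; -(p : ℚ_[p]) / x, 1]) i j‖ ≤ (((p : ℝ)) ^ 2)⁻¹) →
      ∃ k ∈ Kset p,
        !![1, x / (p : ℚ_[p]); 0, 1] * γ =
          k * !![(p : ℚ_[p]), y / (p : ℚ_[p]); 0, ((p : ℚ_[p]))⁻¹] := by
  refine ⟨?_, fun γ hγ h => upperUnipotent_mul_mem_coset hx hy hγ h⟩
  have hl : !![1, 0; -(p : ℚ_[p]) / x, 1] ∈ Kset p :=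
    lowerUnipotent_mem_Kset (by
      rw [norm_div, norm_neg, hx, div_one]
      exact (natCast_mem (PadicInt.subring p) p :))
  obtain ⟨k, hk, hkl⟩ := upperUnipotent_mul_mem_coset hx hy hl fun i j => by
    rw [sub_self, Matrix.zero_apply, norm_zero]
    positivity
  exact DCp_Kset_eq hk hl hkl
end
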